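/- Let f be a function in the Schwartz space S(ℝ) and let 1 ≤ p ≤ ∞. Then the limit lim_{n→∞} ‖Λ_{k,M⁻¹}ⁿ f‖_{L^p_k}^{1/n} exists in [0,∞] and equals σ_f = sup{|λ/b| : λ ∈ supp D_k^M f}. -/

import Mathlib

open MeasureTheory Filter Complex Topology
open scoped ENNReal

noncomputable section

/-- The measure `μ_k` on `ℝ`: `dμ_k(x) = |x|^(2k+1) dx / (2^(k+1) Γ(k+1))`. -/
def muK (k : ℝ) : Measure ℝ :=
  MeasureTheory.volume.withDensity
    (fun x : ℝ => ENNReal.ofReal (|x| ^ (2 * k + 1) / (2 ^ (k + 1) * Real.Gamma (k + 1))))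

/-- The normalized Bessel function `j_k`. -/
def besselJ (k x : ℝ) : ℝ :=
  Real.Gamma (k + 1) *
    ∑' n : ℕ, (-1 : ℝ) ^ n * (x / 2) ^ (2 * n) / ((n.factorial : ℝ) * Real.Gamma ((n : ℝ) + k + 1))

/-- The Dunkl kernel `E_k(iλ, x)`. -/
def dunklKernel (k lam x : ℝ) : ℂ :=
  (besselJ k (lam * x) : ℂ) +
    Complex.I * (lam : ℂ) * (x : ℂ) / (2 * ((k : ℂ) + 1)) * (besselJ (k + 1) (lam * x) : ℂ)

/-- The Dunkl transform `D_k f`. -/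
def dunklT (k : ℝ) (f : ℝ → ℂ) (lam : ℝ) : ℂ :=
  ∫ x : ℝ, f x * dunklKernel k (-lam) x ∂(muK k)

/-- The linear canonical Dunkl transform `D_k^M` for `M = (a, b; c, d)`. -/
def lcdt (k a b d : ℝ) (f : ℝ → ℂ) (lam : ℝ) : ℂ :=
  ((Complex.I * (b : ℂ)) ^ ((k : ℂ) + 1))⁻¹ *
    ∫ x : ℝ, f x *
      Complex.exp (Complex.I / 2 * (((d / b : ℝ) : ℂ) * (lam : ℂ) ^ 2 + ((a / b : ℝ) : ℂ) * (x : ℂ) ^ 2)) *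
      dunklKernel k (-lam / b) x ∂(muK k)

/-- The Dunkl operator `Λ_k`. -/
def dunklOp (k : ℝ) (f : ℝ → ℂ) : ℝ → ℂ := fun x =>
  if x = 0 then (2 * (k : ℂ) + 2) * deriv f 0
  else deriv f x + (((2 * k + 1) / x : ℝ) : ℂ) * ((f x - f (-x)) / 2)

/-- The linear canonical Dunkl operator `Λ_{k,M⁻¹} f(x) = Λ_k f(x) + i (a/b) x f(x)`. -/
def lcdOp (k a b : ℝ) (f : ℝ → ℂ) : ℝ → ℂ := fun x =>
  dunklOp k f x + Complex.I * ((a / b : ℝ) : ℂ) * (x : ℂ) * f x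

/-- The linear canonical Dunkl operator `Λ_{k,M} f(x) = Λ_k f(x) - i (d/b) x f(x)`. -/
def lcdOpM (k d b : ℝ) (f : ℝ → ℂ) : ℝ → ℂ := fun x =>
  dunklOp k f x - Complex.I * ((d / b : ℝ) : ℂ) * (x : ℂ) * f x

/-- The linear canonical Dunkl Laplacian `Δ_{k,M⁻¹} = Λ_{k,M⁻¹} ∘ Λ_{k,M⁻¹}`. -/
def deltaOp (k a b : ℝ) : (ℝ → ℂ) → ℝ → ℂ := fun f => lcdOp k a b (lcdOp k a b f)

/-- The operator `i Λ_{k,M⁻¹}`. -/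
def iLam (k a b : ℝ) : (ℝ → ℂ) → ℝ → ℂ := fun f x => Complex.I * lcdOp k a b f x

/-- The operator `P(i Λ_{k,M⁻¹}) = Σ_j c_j (iΛ_{k,M⁻¹})^j` for `P(t) = Σ_j c_j t^j`. -/
def polyOpI (k a b : ℝ) (P : Polynomial ℝ) : (ℝ → ℂ) → ℝ → ℂ := fun f x =>
  ∑ j ∈ Finset.range (P.natDegree + 1), ((P.coeff j : ℝ) : ℂ) * (iLam k a b)^[j] f x

end

section

open scoped SchwartzMap ContDiff

/-- The power series coefficients of the normalized Bessel function in the variable `x²`. -/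
noncomputable def besselCoeff (k : ℝ) (n : ℕ) : ℝ :=
  Real.Gamma (k + 1) * (-1) ^ n / (4 ^ n * n.factorial * Real.Gamma (n + k + 1))

lemma besselJ_eq_tsum (k x : ℝ) : besselJ k x = ∑' n : ℕ, besselCoeff k n * x ^ (2 * n) := by
  rw [besselJ, ← tsum_mul_left]
  refine tsum_congr fun n => ?_
  rw [besselCoeff, div_pow, pow_mul 2 2 n]
  norm_num
  ring

lemma Gamma_nat_add_pos {k : ℝ} (hk : -(1/2) ≤ k) (n : ℕ) : 0 < Real.Gamma (n + k + 1) := by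
  apply Real.Gamma_pos_of_pos
  have : (0 : ℝ) ≤ n := n.cast_nonneg
  linarith

lemma Gamma_nat_succ_add {k : ℝ} (hk : -(1/2) ≤ k) (n : ℕ) :
    Real.Gamma ((n : ℝ) + 1 + k + 1) = (n + k + 1) * Real.Gamma (n + k + 1) := by
  have : (0 : ℝ) ≤ n := n.cast_nonneg
  rw [← Real.Gamma_add_one (by linarith)]
  ring_nf

lemma pow_mul_Gamma_le {k : ℝ} (hk : -(1/2) ≤ k) (n : ℕ) :
    (1/2) ^ n * Real.Gamma (k + 1) ≤ Real.Gamma (n + k + 1) := by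
  induction n with
  | zero => simp
  | succ n ih =>
    have h0 := Gamma_nat_add_pos hk n
    have : (0 : ℝ) ≤ n := n.cast_nonneg
    push_cast
    rw [Gamma_nat_succ_add hk, pow_succ]
    nlinarith

lemma abs_besselCoeff_le {k : ℝ} (hk : -(1/2) ≤ k) (n : ℕ) :
    |besselCoeff k n| ≤ (1/2) ^ n / n.factorial := by
  have h0 := Gamma_nat_add_pos hk n
  have h1 : 0 < Real.Gamma (k + 1) := Real.Gamma_pos_of_pos (by linarith)
  have hf : (0 : ℝ) < n.factorial := by positivity
  rw [besselCoeff, abs_div, abs_mul, abs_pow, abs_neg, abs_one, one_pow, mul_one, abs_of_pos h1,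
    abs_of_pos (by positivity), div_le_div_iff₀ (by positivity) hf]
  have h2 := pow_mul_Gamma_le hk n
  have h4 : (1/2 : ℝ) ^ n * 4 ^ n * (1/2) ^ n = 1 := by
    rw [← mul_pow, ← mul_pow]; norm_num
  calc Real.Gamma (k + 1) * n.factorial
      = ((1/2) ^ n * 4 ^ n * (1/2) ^ n) * Real.Gamma (k + 1) * n.factorial := by rw [h4]; ring
    _ = (1/2) ^ n * 4 ^ n * n.factorial * ((1/2) ^ n * Real.Gamma (k + 1)) := by ring
    _ ≤ (1/2) ^ n * 4 ^ n * n.factorial * Real.Gamma (n + k + 1) := by gcongr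
    _ = _ := by ring

lemma summable_besselCoeff_mul_pow {k : ℝ} (hk : -(1/2) ≤ k) (x : ℝ) :
    Summable fun n : ℕ => besselCoeff k n * x ^ (2 * n) := by
  refine Summable.of_norm_bounded (Real.summable_pow_div_factorial (x ^ 2 / 2)) fun n => ?_
  rw [Real.norm_eq_abs, abs_mul, pow_mul, abs_pow, abs_of_nonneg (sq_nonneg x)]
  calc _ ≤ (1/2) ^ n / n.factorial * (x ^ 2) ^ n := by
        gcongr
        exact abs_besselCoeff_le hk n
    _ = _ := by rw [div_pow, div_pow, one_pow]; ring

lemma norm_besselCoeff_deriv_le {k : ℝ} (hk : -(1/2) ≤ k) {R y : ℝ} (hR : 1 ≤ R)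
    (hy : |y| ≤ R) (n : ℕ) :
    ‖besselCoeff k n * (((2 * n : ℕ) : ℝ) * y ^ (2 * n - 1))‖ ≤
      2 * ((R ^ 2) ^ n / n.factorial) := by
  rw [norm_mul, norm_mul, norm_pow, Real.norm_eq_abs, Real.norm_eq_abs, Real.norm_eq_abs]
  have h1 : |y| ^ (2 * n - 1) ≤ (R ^ 2) ^ n := by
    rw [← pow_mul]
    calc |y| ^ (2 * n - 1) ≤ R ^ (2 * n - 1) := by gcongr
      _ ≤ R ^ (2 * n) := pow_le_pow_right₀ hR (Nat.sub_le _ _)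
  have h2 : |((2 * n : ℕ) : ℝ)| ≤ 2 * 2 ^ n := by
    rw [abs_of_nonneg (by positivity)]
    have : (n : ℝ) ≤ 2 ^ n := by exact_mod_cast Nat.lt_two_pow_self.le
    push_cast
    linarith
  calc _ ≤ (1/2) ^ n / n.factorial * ((2 * 2 ^ n) * (R ^ 2) ^ n) := by
        gcongr
        exact abs_besselCoeff_le hk n
    _ = 2 * ((1/2 * 2) ^ n * (R ^ 2) ^ n / n.factorial) := by rw [mul_pow]; ring
    _ = _ := by norm_num

lemma summable_besselCoeff_deriv {k : ℝ} (hk : -(1/2) ≤ k) (x : ℝ) :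
    Summable fun n : ℕ => besselCoeff k n * (((2 * n : ℕ) : ℝ) * x ^ (2 * n - 1)) :=
  Summable.of_norm_bounded ((Real.summable_pow_div_factorial _).mul_left 2) fun n =>
    norm_besselCoeff_deriv_le hk (R := |x| + 1) (by linarith [abs_nonneg x]) (by linarith) n

lemma hasDerivAt_besselJ_tsum {k : ℝ} (hk : -(1/2) ≤ k) (x : ℝ) :
    HasDerivAt (besselJ k)
      (∑' n : ℕ, besselCoeff k n * (((2 * n : ℕ) : ℝ) * x ^ (2 * n - 1))) x := by
  have h : besselJ k = fun x => ∑' n : ℕ, besselCoeff k n * x ^ (2 * n) :=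
    funext (besselJ_eq_tsum k)
  rw [h]
  have hx : x ∈ Metric.ball (0 : ℝ) (|x| + 1) := by simp
  refine hasDerivAt_tsum_of_isPreconnected
    (u := fun n : ℕ => 2 * (((|x| + 1) ^ 2) ^ n / (n.factorial : ℝ)))
    ((Real.summable_pow_div_factorial _).mul_left 2) Metric.isOpen_ball
    (convex_ball _ _).isPreconnected (fun n y _ => (hasDerivAt_pow (2 * n) y).const_mul _)
    (fun n y hy => ?_) hx (summable_besselCoeff_mul_pow hk x) hx
  refine norm_besselCoeff_deriv_le hk (by linarith [abs_nonneg x]) ?_ n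
  simpa using (mem_ball_zero_iff.mp hy).le

lemma hasDerivAt_besselJ {k : ℝ} (hk : -(1/2) ≤ k) (x : ℝ) :
    HasDerivAt (besselJ k) (-(x / (2 * (k + 1)) * besselJ (k + 1) x)) x := by
  convert hasDerivAt_besselJ_tsum hk x using 1
  rw [(summable_besselCoeff_deriv hk x).tsum_eq_zero_add, besselJ_eq_tsum, ← tsum_mul_left,
    ← tsum_neg]
  simp only [mul_zero, Nat.cast_zero, zero_mul, zero_add]
  refine tsum_congr fun n => ?_
  have h0 := Gamma_nat_add_pos (k := k + 1) (by linarith) n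
  have h1 : Real.Gamma (k + 1 + 1) = (k + 1) * Real.Gamma (k + 1) :=
    Real.Gamma_add_one (by linarith)
  have h2 : 2 * (n + 1) - 1 = 2 * n + 1 := by omega
  have h3 : ((n : ℝ) + 1 + k + 1) = n + (k + 1) + 1 := by ring
  have h4 : k + 1 ≠ 0 := by linarith
  rw [besselCoeff, besselCoeff, h1, h2]
  push_cast
  rw [h3, Nat.factorial_succ]
  push_cast
  field_simp
  ring

lemma besselJ_succ_add {k : ℝ} (hk : -(1/2) ≤ k) (x : ℝ) :
    besselJ (k + 1) x + x / (2 * (k + 1)) *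
      (-(x / (2 * (k + 1 + 1)) * besselJ (k + 1 + 1) x)) = besselJ k x := by
  have hk' : -(1/2) ≤ k + 1 := by linarith
  rw [(hasDerivAt_besselJ hk' x).unique (hasDerivAt_besselJ_tsum hk' x), besselJ_eq_tsum,
    besselJ_eq_tsum, ← tsum_mul_left, ← Summable.tsum_add (summable_besselCoeff_mul_pow hk' x)
      ((summable_besselCoeff_deriv hk' x).mul_left _)]
  refine tsum_congr fun n => ?_
  have h0 := Gamma_nat_add_pos hk n
  have hn : (0 : ℝ) ≤ n := n.cast_nonneg
  have h1 : Real.Gamma (k + 1 + 1) = (k + 1) * Real.Gamma (k + 1) :=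
    Real.Gamma_add_one (by linarith)
  have h2 : Real.Gamma (n + (k + 1) + 1) = (n + k + 1) * Real.Gamma (n + k + 1) := by
    rw [← Gamma_nat_succ_add hk]; ring_nf
  have h4 : k + 1 ≠ 0 := by linarith
  have h5 : (n : ℝ) + k + 1 ≠ 0 := by linarith
  have h6 : x * (((2 * n : ℕ) : ℝ) * x ^ (2 * n - 1)) = 2 * n * x ^ (2 * n) := by
    rcases n with _ | n
    · simp
    · rw [show 2 * (n + 1) - 1 = 2 * n + 1 by omega]
      push_cast
      ring
  rw [show x / (2 * (k + 1)) * (besselCoeff (k + 1) n * (((2 * n : ℕ) : ℝ) * x ^ (2 * n - 1)))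
    = besselCoeff (k + 1) n / (2 * (k + 1)) * (x * (((2 * n : ℕ) : ℝ) * x ^ (2 * n - 1))) by ring,
    h6, besselCoeff, besselCoeff, h1, h2]
  field_simp
  ring

lemma besselJ_zero_right {k : ℝ} (hk : -(1/2) ≤ k) : besselJ k 0 = 1 := by
  have h1 : 0 < Real.Gamma (k + 1) := Real.Gamma_pos_of_pos (by linarith)
  rw [besselJ_eq_tsum, tsum_eq_single 0 (fun n hn => by simp [hn])]
  simp [besselCoeff, h1.ne']

lemma besselJ_neg (k x : ℝ) : besselJ k (-x) = besselJ k x := by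
  simp [besselJ_eq_tsum, pow_mul]

/-- The odd part `x j_{k+1}(x) / (2(k+1))` of the Dunkl kernel. -/
noncomputable def besselO (k x : ℝ) : ℝ := x / (2 * (k + 1)) * besselJ (k + 1) x

lemma besselO_neg (k x : ℝ) : besselO k (-x) = -besselO k x := by
  rw [besselO, besselO, besselJ_neg]; ring

lemma hasDerivAt_besselO {k : ℝ} (hk : -(1/2) ≤ k) (x : ℝ) :
    HasDerivAt (besselO k)
      (besselJ k x - (2 * k + 1) / (2 * (k + 1)) * besselJ (k + 1) x) x := by
  have h4 : k + 1 ≠ 0 := by linarith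
  refine (((hasDerivAt_id x).div_const (2 * (k + 1))).mul
    (hasDerivAt_besselJ (k := k + 1) (by linarith) x)).congr_deriv ?_
  have := besselJ_succ_add hk x
  rw [← this]
  simp only [id]
  field_simp
  ring

lemma besselJ_sq_add_besselO_sq_le {k : ℝ} (hk : -(1/2) ≤ k) (x : ℝ) :
    besselJ k x ^ 2 + besselO k x ^ 2 ≤ 1 := by
  have hd : ∀ x, HasDerivAt (fun x => besselJ k x ^ 2 + besselO k x ^ 2)
      (-(x * (2 * (2 * k + 1) * (besselJ (k + 1) x / (2 * (k + 1))) ^ 2))) x := fun x => by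
    have h4 : k + 1 ≠ 0 := by linarith
    refine (((hasDerivAt_besselJ hk x).pow 2).add ((hasDerivAt_besselO hk x).pow 2)).congr_deriv ?_
    simp only [besselO, Nat.cast_ofNat, Nat.add_one_sub_one, pow_one]
    generalize besselJ (k + 1) x = u
    field_simp
    ring
  have hanti : AntitoneOn (fun x => besselJ k x ^ 2 + besselO k x ^ 2) (Set.Ici 0) := by
    refine antitoneOn_of_deriv_nonpos (convex_Ici 0)
      (fun x _ => (hd x).continuousAt.continuousWithinAt)
      (fun x _ => (hd x).differentiableAt.differentiableWithinAt) fun x hx => ?_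
    rw [(hd x).deriv]
    have h0 : 0 ≤ x := by simpa using (interior_subset hx)
    have : 0 ≤ 2 * k + 1 := by linarith
    have : 0 ≤ x * (2 * (2 * k + 1) * (besselJ (k + 1) x / (2 * (k + 1))) ^ 2) := by positivity
    linarith
  have habs : besselJ k |x| ^ 2 + besselO k |x| ^ 2 = besselJ k x ^ 2 + besselO k x ^ 2 := by
    rcases abs_choice x with h | h <;> rw [h]
    rw [besselJ_neg, besselO_neg]; ring
  have := hanti (Set.mem_Ici.mpr le_rfl) (Set.mem_Ici.mpr (abs_nonneg x)) (abs_nonneg x)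
  simp only [habs] at this
  simpa [besselJ_zero_right hk, besselO] using this

lemma abs_besselJ_le_one {k : ℝ} (hk : -(1/2) ≤ k) (x : ℝ) : |besselJ k x| ≤ 1 := by
  rw [← sq_le_one_iff_abs_le_one]
  nlinarith [besselJ_sq_add_besselO_sq_le hk x, sq_nonneg (besselO k x)]

lemma abs_besselO_le_one {k : ℝ} (hk : -(1/2) ≤ k) (x : ℝ) : |besselO k x| ≤ 1 := by
  rw [← sq_le_one_iff_abs_le_one]
  nlinarith [besselJ_sq_add_besselO_sq_le hk x, sq_nonneg (besselJ k x)]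

/-- The Dunkl kernel as a function of one variable: `E_k(iλ, x) = dunklE k (λ x)`. -/
noncomputable def dunklE (k t : ℝ) : ℂ := (besselJ k t : ℂ) + I * (besselO k t : ℂ)

lemma dunklKernel_eq (k lam x : ℝ) : dunklKernel k lam x = dunklE k (lam * x) := by
  simp only [dunklKernel, dunklE, besselO]
  push_cast
  ring

lemma norm_dunklE_le_one {k : ℝ} (hk : -(1/2) ≤ k) (t : ℝ) : ‖dunklE k t‖ ≤ 1 := by
  rw [← sq_le_one_iff₀ (norm_nonneg _), ← Complex.normSq_eq_norm_sq, dunklE, mul_comm I,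
    Complex.normSq_add_mul_I]
  exact besselJ_sq_add_besselO_sq_le hk t

lemma dunklE_zero {k : ℝ} (hk : -(1/2) ≤ k) : dunklE k 0 = 1 := by
  simp [dunklE, besselJ_zero_right hk, besselO]

lemma conj_dunklE (k t : ℝ) : (starRingEnd ℂ) (dunklE k t) = dunklE k (-t) := by
  simp [dunklE, besselJ_neg, besselO_neg]

/-- The derivative of `dunklE k`. -/
noncomputable def dunklE' (k t : ℝ) : ℂ :=
  ((-besselO k t : ℝ) : ℂ) +
    I * ((besselJ k t - (2 * k + 1) / (2 * (k + 1)) * besselJ (k + 1) t : ℝ) : ℂ)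

lemma hasDerivAt_dunklE {k : ℝ} (hk : -(1/2) ≤ k) (t : ℝ) :
    HasDerivAt (dunklE k) (dunklE' k t) t :=
  (hasDerivAt_besselJ hk t).ofReal_comp.add ((hasDerivAt_besselO hk t).ofReal_comp.const_mul I)

lemma norm_dunklE'_le {k : ℝ} (hk : -(1/2) ≤ k) (t : ℝ) : ‖dunklE' k t‖ ≤ 3 := by
  have h1 := abs_besselO_le_one hk t
  have h2 := abs_besselJ_le_one hk t
  have h3 := abs_besselJ_le_one (k := k + 1) (by linarith) t
  have h4 : |(2 * k + 1) / (2 * (k + 1))| ≤ 1 := by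
    rw [abs_of_nonneg (div_nonneg (by linarith) (by linarith)), div_le_one (by linarith)]
    linarith
  calc ‖dunklE' k t‖ ≤ |besselO k t| +
        |besselJ k t - (2 * k + 1) / (2 * (k + 1)) * besselJ (k + 1) t| := by
        refine (norm_add_le _ _).trans ?_
        rw [norm_mul, Complex.norm_I, one_mul, Complex.norm_real, Complex.norm_real, norm_neg]
        rfl
    _ ≤ 1 + (1 + 1 * 1) := by
        gcongr
        refine (abs_sub _ _).trans ?_
        rw [abs_mul]
        gcongr
    _ = 3 := by norm_num

lemma continuous_dunklE {k : ℝ} (hk : -(1/2) ≤ k) : Continuous (dunklE k) :=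
  continuous_iff_continuousAt.mpr fun t => (hasDerivAt_dunklE hk t).continuousAt

lemma continuous_dunklE' {k : ℝ} (hk : -(1/2) ≤ k) : Continuous (dunklE' k) := by
  have hJ : ∀ k, -(1/2) ≤ k → Continuous (besselJ k) := fun k hk =>
    continuous_iff_continuousAt.mpr fun t => (hasDerivAt_besselJ hk t).continuousAt
  have h1 := hJ k hk
  have h2 := hJ (k + 1) (by linarith)
  unfold dunklE' besselO
  fun_prop

lemma hasDerivAt_dunklE_mul {k : ℝ} (hk : -(1/2) ≤ k) (lam x : ℝ) :
    HasDerivAt (fun x => dunklE k (lam * x)) (lam * dunklE' k (lam * x)) x := by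
  have := (hasDerivAt_dunklE hk (lam * x)).scomp x ((hasDerivAt_id x).const_mul lam)
  simpa [Function.comp_def] using this

/-- The Dunkl kernel is an eigenfunction of the Dunkl operator. -/
lemma dunklOp_dunklE {k : ℝ} (hk : -(1/2) ≤ k) (lam x : ℝ) :
    dunklOp k (fun x => dunklE k (lam * x)) x = I * lam * dunklE k (lam * x) := by
  have h4 : (k : ℂ) + 1 ≠ 0 := by
    norm_cast; linarith
  rw [dunklOp]
  split_ifs with hx
  · subst hx
    rw [(hasDerivAt_dunklE_mul hk lam 0).deriv, mul_zero, dunklE_zero hk, dunklE',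
      besselJ_zero_right hk, besselJ_zero_right (by linarith), besselO]
    push_cast
    field_simp
    ring
  · have hx' : (x : ℂ) ≠ 0 := by exact_mod_cast hx
    rw [(hasDerivAt_dunklE_mul hk lam x).deriv, mul_neg, dunklE, dunklE, dunklE', besselJ_neg,
      besselO_neg]
    have : ((besselO k (lam * x) : ℝ) : ℂ)
        = lam * x / (2 * (k + 1)) * besselJ (k + 1) (lam * x) := by
      rw [besselO]; push_cast; ring
    push_cast
    rw [this]
    field_simp
    ring_nf
    simp only [Complex.I_sq]
    ring

/-- A family of differentiable, rapidly decreasing functions that is stable under differentiation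
consists of Schwartz functions. -/
lemma exists_schwartzMap_of_family (S : Set (ℝ → ℂ)) (hd : ∀ f ∈ S, Differentiable ℝ f)
    (hder : ∀ f ∈ S, deriv f ∈ S)
    (hdec : ∀ f ∈ S, ∀ m : ℕ, ∃ C : ℝ, ∀ x : ℝ, |x| ^ m * ‖f x‖ ≤ C) {f : ℝ → ℂ} (hf : f ∈ S) :
    ∃ g : 𝓢(ℝ, ℂ), ⇑g = f := by
  have hS : ∀ n : ℕ, ∀ f ∈ S, iteratedDeriv n f ∈ S := by
    intro n
    induction n with
    | zero => intro f hf; simpa using hf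
    | succ n ih =>
      intro f hf
      rw [iteratedDeriv_succ']
      exact ih _ (hder f hf)
  have hsm : ContDiff ℝ ∞ f := by
    rw [contDiff_infty]
    intro n
    refine contDiff_of_differentiable_iteratedDeriv fun m _ => hd _ (hS m f hf)
  refine ⟨⟨f, hsm, fun m n => ?_⟩, rfl⟩
  obtain ⟨C, hC⟩ := hdec _ (hS n f hf) m
  refine ⟨C, fun x => ?_⟩
  rw [norm_iteratedFDeriv_eq_norm_iteratedDeriv]
  exact hC x

lemma SchwartzMap.differentiable_real (f : 𝓢(ℝ, ℂ)) : Differentiable ℝ f :=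
  (f.smooth 1).differentiable (by simp)

lemma hasTemperateGrowth_ofReal : Function.HasTemperateGrowth (fun x : ℝ => (x : ℂ)) :=
  Complex.ofRealCLM.hasTemperateGrowth

/-- Multiplication of a Schwartz function by the coordinate. -/
noncomputable def mulX (f : 𝓢(ℝ, ℂ)) : 𝓢(ℝ, ℂ) :=
  SchwartzMap.smulLeftCLM ℂ (fun x : ℝ => (x : ℂ)) f

@[simp] lemma mulX_apply (f : 𝓢(ℝ, ℂ)) (x : ℝ) : mulX f x = x * f x := by
  simp [mulX, SchwartzMap.smulLeftCLM_apply_apply hasTemperateGrowth_ofReal]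

/-- Reflection of a Schwartz function. -/
noncomputable def reflX (f : 𝓢(ℝ, ℂ)) : 𝓢(ℝ, ℂ) :=
  SchwartzMap.compCLMOfContinuousLinearEquiv ℂ (ContinuousLinearEquiv.neg ℝ) f

@[simp] lemma reflX_apply (f : 𝓢(ℝ, ℂ)) (x : ℝ) : reflX f x = f (-x) := rfl

/-- The derivative of a Schwartz function. -/
noncomputable def derivX (f : 𝓢(ℝ, ℂ)) : 𝓢(ℝ, ℂ) := SchwartzMap.derivCLM ℂ ℂ f

@[simp] lemma derivX_apply (f : 𝓢(ℝ, ℂ)) (x : ℝ) : derivX f x = deriv f x := rfl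

lemma hasDerivAt_hadamard_integral {g : ℝ → ℂ} (hg : ContDiff ℝ ∞ g) (m : ℕ) (x₀ x : ℝ) :
    HasDerivAt (fun x : ℝ => ∫ t in (0:ℝ)..1, (t : ℂ) ^ m * g (x₀ + t * (x - x₀)))
      (∫ t in (0:ℝ)..1, (t : ℂ) ^ (m + 1) * deriv g (x₀ + t * (x - x₀))) x := by
  have hc : Continuous g := hg.continuous
  have hc' : Continuous (deriv g) := hg.continuous_deriv (by simp)
  obtain ⟨C, hC⟩ := (isCompact_closedBall x₀ (|x - x₀| + 1)).exists_bound_of_continuousOn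
    hc'.continuousOn
  refine (intervalIntegral.hasDerivAt_integral_of_dominated_loc_of_deriv_le
    (F := fun x t => (t : ℂ) ^ m * g (x₀ + t * (x - x₀)))
    (F' := fun x t => (t : ℂ) ^ (m + 1) * deriv g (x₀ + t * (x - x₀))) (bound := fun _ => C)
    (Metric.ball_mem_nhds x one_pos) (Eventually.of_forall fun y => ?_) ?_ ?_ ?_ ?_ ?_).2
  · exact Continuous.aestronglyMeasurable (by fun_prop)
  · exact Continuous.intervalIntegrable (by fun_prop) _ _
  · exact Continuous.aestronglyMeasurable (by fun_prop)
  · refine Eventually.of_forall fun t ht y hy => ?_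
    rw [Set.uIoc_of_le zero_le_one] at ht
    have h1 : |t| ≤ 1 := abs_le.mpr ⟨by linarith [ht.1], ht.2⟩
    have h2 : ‖(t : ℂ) ^ (m + 1)‖ ≤ 1 := by
      rw [norm_pow, Complex.norm_real]
      exact pow_le_one₀ (abs_nonneg _) h1
    have h3 : |y - x₀| ≤ |x - x₀| + 1 := by
      rw [Metric.mem_ball, Real.dist_eq] at hy
      have := abs_add_le (y - x) (x - x₀)
      rw [sub_add_sub_cancel] at this
      linarith
    have h4 : x₀ + t * (y - x₀) ∈ Metric.closedBall x₀ (|x - x₀| + 1) := by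
      rw [Metric.mem_closedBall, Real.dist_eq, add_sub_cancel_left, abs_mul]
      calc |t| * |y - x₀| ≤ 1 * (|x - x₀| + 1) := by gcongr
        _ = _ := one_mul _
    rw [norm_mul]
    calc _ ≤ 1 * C := by
          gcongr
          exact hC _ h4
      _ = C := one_mul C
  · exact intervalIntegrable_const
  · refine Eventually.of_forall fun t _ y _ => ?_
    have h1 : HasDerivAt (fun y : ℝ => x₀ + t * (y - x₀)) t y := by
      simpa using (((hasDerivAt_id y).sub_const x₀).const_mul t).const_add x₀
    have h2 : HasDerivAt g (deriv g (x₀ + t * (y - x₀))) (x₀ + t * (y - x₀)) :=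
      ((hg.differentiable (by simp)) _).hasDerivAt
    have h3 := (h2.scomp y h1).const_mul ((t : ℂ) ^ m)
    refine h3.congr_deriv ?_
    rw [Complex.real_smul]
    ring

lemma contDiff_hadamard_integral (n : ℕ) : ∀ {g : ℝ → ℂ} (_ : ContDiff ℝ ∞ g) (m : ℕ) (x₀ : ℝ),
    ContDiff ℝ n (fun x : ℝ => ∫ t in (0:ℝ)..1, (t : ℂ) ^ m * g (x₀ + t * (x - x₀))) := by
  induction n with
  | zero =>
    intro g hg m x₀
    exact contDiff_zero.mpr (continuous_iff_continuousAt.mpr fun x =>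
      (hasDerivAt_hadamard_integral hg m x₀ x).continuousAt)
  | succ n ih =>
    intro g hg m x₀
    push_cast
    rw [contDiff_succ_iff_deriv]
    refine ⟨fun x => (hasDerivAt_hadamard_integral hg m x₀ x).differentiableAt, by simp, ?_⟩
    rw [funext fun x => (hasDerivAt_hadamard_integral hg m x₀ x).deriv]
    exact ih (contDiff_infty_iff_deriv.mp hg).2 _ _

/-- Hadamard's lemma: a smooth function vanishing at a point is smoothly divisible. -/
lemma ContDiff.exists_eq_sub_mul {f : ℝ → ℂ} (hf : ContDiff ℝ ∞ f) {x₀ : ℝ} (h0 : f x₀ = 0) :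
    ∃ h : ℝ → ℂ, ContDiff ℝ ∞ h ∧ ∀ x, f x = ((x : ℂ) - x₀) * h x := by
  have hf' := (contDiff_infty_iff_deriv.mp hf).2
  refine ⟨_, contDiff_infty.mpr fun n => contDiff_hadamard_integral n hf' 0 x₀, fun x => ?_⟩
  have hd : ∀ t ∈ Set.uIcc (0:ℝ) 1, HasDerivAt (fun t : ℝ => f (x₀ + t * (x - x₀)))
      (((x : ℂ) - x₀) * deriv f (x₀ + t * (x - x₀))) t := fun t _ => by
    have h1 : HasDerivAt (fun t : ℝ => x₀ + t * (x - x₀)) (x - x₀) t := by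
      simpa using ((hasDerivAt_id t).mul_const (x - x₀)).const_add x₀
    have h2 : HasDerivAt f (deriv f (x₀ + t * (x - x₀))) (x₀ + t * (x - x₀)) :=
      ((hf.differentiable (by simp)) _).hasDerivAt
    refine (h2.scomp t h1).congr_deriv ?_
    rw [Complex.real_smul]
    push_cast
    rfl
  have hc := hf'.continuous
  have := intervalIntegral.integral_eq_sub_of_hasDerivAt hd
    (Continuous.intervalIntegrable (by fun_prop) _ _)
  simp only [one_mul, add_sub_cancel, zero_mul, add_zero, h0, sub_zero,
    intervalIntegral.integral_const_mul] at this
  simp only [pow_zero, one_mul]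
  exact this.symm

/-- A smooth function that becomes a Schwartz function after multiplication by a power of
`x - x₀` is a Schwartz function. -/
lemma exists_schwartzMap_of_sub_pow_mul {h : ℝ → ℂ} (hh : ContDiff ℝ ∞ h) (x₀ : ℝ) (N : ℕ)
    (f : 𝓢(ℝ, ℂ)) (hf : ∀ x, f x = ((x : ℂ) - x₀) ^ N * h x) : ∃ g : 𝓢(ℝ, ℂ), ⇑g = h := by
  refine exists_schwartzMap_of_family
    {h | ContDiff ℝ ∞ h ∧ ∃ (N : ℕ) (f : 𝓢(ℝ, ℂ)), ∀ x, f x = ((x : ℂ) - x₀) ^ N * h x}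
    (fun h hh => hh.1.differentiable (by simp)) ?_ ?_ ⟨hh, N, f, hf⟩
  · rintro h ⟨hh, N, f, hf⟩
    refine ⟨(contDiff_infty_iff_deriv.mp hh).2, N + 1,
      mulX (derivX f) - (x₀ : ℂ) • derivX f - (N : ℂ) • f, fun x => ?_⟩
    have h1 : HasDerivAt (fun x : ℝ => (x : ℂ) - x₀) 1 x :=
      (Complex.ofRealCLM.hasDerivAt (x := x)).sub_const _
    have h2 := (h1.pow N).mul ((hh.differentiable (by simp)) x).hasDerivAt
    have h3 : deriv f x = _ := (h2.congr_of_eventuallyEq (Eventually.of_forall hf)).deriv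
    simp only [sub_apply, smul_apply, mulX_apply, derivX_apply, h3, hf,
      smul_eq_mul, Pi.pow_apply]
    rcases N with _ | N
    · simp
      ring
    · push_cast
      ring
  · rintro h ⟨hh, N, f, hf⟩ m
    obtain ⟨C₁, hC₁⟩ := (isCompact_closedBall x₀ 1).exists_bound_of_continuousOn
      (f := fun x : ℝ => ((|x| ^ m : ℝ) : ℂ) * h x) (by have := hh.continuous; fun_prop)
    obtain ⟨C₂, hC₂⟩ := f.decay m 0
    refine ⟨max C₁ C₂, fun x => ?_⟩
    rcases le_total |x - x₀| 1 with hx | hx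
    · have := hC₁ x (by simpa [Real.dist_eq] using hx)
      rw [norm_mul, Complex.norm_real, Real.norm_eq_abs, abs_pow, abs_abs] at this
      exact this.trans (le_max_left _ _)
    · have := hC₂.2 x
      rw [norm_iteratedFDeriv_zero, hf, norm_mul, norm_pow, Real.norm_eq_abs] at this
      refine le_trans ?_ (this.trans (le_max_right _ _))
      gcongr
      refine le_mul_of_one_le_left (norm_nonneg _) (one_le_pow₀ ?_)
      rw [← Complex.ofReal_sub, Complex.norm_real]
      exact hx

/-- A Schwartz function vanishing at a point is divisible within the Schwartz space. -/
lemma SchwartzMap.exists_eq_sub_mul (f : 𝓢(ℝ, ℂ)) {x₀ : ℝ} (h0 : f x₀ = 0) :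
    ∃ h : 𝓢(ℝ, ℂ), ∀ x, f x = ((x : ℂ) - x₀) * h x := by
  obtain ⟨h, hh, hfh⟩ := ContDiff.exists_eq_sub_mul (f.smooth ⊤) h0
  obtain ⟨g, rfl⟩ := exists_schwartzMap_of_sub_pow_mul hh x₀ 1 f (by simpa using hfh)
  exact ⟨g, hfh⟩

lemma hasDerivAt_exp_mul_sq (z : ℂ) (x : ℝ) :
    HasDerivAt (fun x : ℝ => cexp (z * (x : ℂ) ^ 2)) (2 * z * x * cexp (z * (x : ℂ) ^ 2)) x := by
  have h1 : HasDerivAt (fun x : ℝ => (x : ℂ)) 1 x := Complex.ofRealCLM.hasDerivAt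
  refine (((h1.pow 2).const_mul z).cexp).congr_deriv ?_
  simp only [Nat.cast_ofNat, Nat.add_one_sub_one, pow_one, mul_one, Pi.pow_apply]
  ring

lemma norm_cexp_mul_I_sq (c x : ℝ) : ‖cexp (c * I * (x : ℂ) ^ 2)‖ = 1 := by
  rw [show (c : ℂ) * I * (x : ℂ) ^ 2 = ((c * x ^ 2 : ℝ) : ℂ) * I by push_cast; ring]
  exact Complex.norm_exp_ofReal_mul_I _

/-- Multiplication by a chirp preserves the Schwartz space. -/
lemma exists_schwartzMap_chirp_mul (c : ℝ) (f : 𝓢(ℝ, ℂ)) :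
    ∃ g : 𝓢(ℝ, ℂ), ∀ x, g x = cexp (c * I * (x : ℂ) ^ 2) * f x := by
  have := exists_schwartzMap_of_family
    {g | ∃ f : 𝓢(ℝ, ℂ), g = fun x : ℝ => cexp (c * I * (x : ℂ) ^ 2) * f x}
    ?_ ?_ ?_ ⟨f, rfl⟩
  · obtain ⟨g, hg⟩ := this
    exact ⟨g, congrFun hg⟩
  · rintro _ ⟨f, rfl⟩ x
    exact ((hasDerivAt_exp_mul_sq _ x).mul (f.differentiable_real x).hasDerivAt).differentiableAt
  · rintro _ ⟨f, rfl⟩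
    refine ⟨derivX f + (2 * (c * I)) • mulX f, funext fun x => ?_⟩
    refine ((hasDerivAt_exp_mul_sq _ x).mul (f.differentiable_real x).hasDerivAt).deriv.trans ?_
    simp only [add_apply, smul_apply, mulX_apply, derivX_apply,
      smul_eq_mul]
    ring
  · rintro _ ⟨f, rfl⟩ m
    obtain ⟨C, -, hC⟩ := f.decay m 0
    refine ⟨C, fun x => ?_⟩
    simpa [norm_cexp_mul_I_sq] using hC x

lemma cexp_neg_half_sq (x : ℝ) :
    cexp (-(1/2) * (x : ℂ) ^ 2) = ((Real.exp (-(1/2) * x ^ 2) : ℝ) : ℂ) := by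
  push_cast; rfl

/-- The Gaussian is a Schwartz function. -/
lemma exists_schwartzMap_gaussian :
    ∃ g : 𝓢(ℝ, ℂ), ∀ x : ℝ, g x = cexp (-(1/2) * (x : ℂ) ^ 2) := by
  have := exists_schwartzMap_of_family
    {g | ∃ P : Polynomial ℂ, g = fun x : ℝ => P.eval (x : ℂ) * cexp (-(1/2) * (x : ℂ) ^ 2)}
    (f := fun x : ℝ => cexp (-(1/2) * (x : ℂ) ^ 2)) ?_ ?_ ?_ ⟨1, by simp⟩
  · obtain ⟨g, hg⟩ := this
    exact ⟨g, congrFun hg⟩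
  · rintro _ ⟨P, rfl⟩ x
    exact ((P.hasDerivAt (x : ℂ)).comp_ofReal.mul (hasDerivAt_exp_mul_sq _ x)).differentiableAt
  · rintro _ ⟨P, rfl⟩
    refine ⟨P.derivative - Polynomial.X * P, funext fun x => ?_⟩
    refine ((P.hasDerivAt (x : ℂ)).comp_ofReal.mul (hasDerivAt_exp_mul_sq _ x)).deriv.trans ?_
    simp only [Polynomial.eval_sub, Polynomial.eval_mul, Polynomial.eval_X]
    ring
  · rintro _ ⟨P, rfl⟩ m
    have key : ∀ n : ℕ, ∃ C : ℝ, ∀ x : ℝ, |x| ^ n * ‖cexp (-(1/2) * (x : ℂ) ^ 2)‖ ≤ C := fun n => by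
      refine ⟨1 + 2 ^ n * n.factorial, fun x => ?_⟩
      rw [cexp_neg_half_sq, Complex.norm_real, Real.norm_eq_abs, Real.abs_exp]
      have hu : 0 ≤ 1/2 * x ^ 2 := by positivity
      have h1 : (1/2 * x ^ 2) ^ n ≤ n.factorial * Real.exp (1/2 * x ^ 2) := by
        have := Real.pow_div_factorial_le_exp _ hu n
        rw [div_le_iff₀ (by positivity)] at this
        linarith
      have h2 : |x| ^ n ≤ 1 + 2 ^ n * (1/2 * x ^ 2) ^ n := by
        rw [← mul_pow, show 2 * (1/2 * x ^ 2) = |x| ^ 2 by rw [sq_abs]; ring, ← pow_mul]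
        rcases le_total |x| 1 with h | h
        · have := pow_le_one₀ (n := n) (abs_nonneg x) h
          have : 0 ≤ |x| ^ (2 * n) := by positivity
          linarith
        · have := pow_le_pow_right₀ h (show n ≤ 2 * n by omega)
          linarith
      have h3 : Real.exp (1/2 * x ^ 2) * Real.exp (-(1/2) * x ^ 2) = 1 := by
        rw [← Real.exp_add]; simp
      have h4 : Real.exp (-(1/2) * x ^ 2) ≤ 1 := Real.exp_le_one_iff.mpr (by linarith)
      calc |x| ^ n * Real.exp (-(1/2) * x ^ 2)
          ≤ (1 + 2 ^ n * (n.factorial * Real.exp (1/2 * x ^ 2))) * Real.exp (-(1/2) * x ^ 2) := by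
            gcongr
            exact h2.trans (by gcongr)
        _ = Real.exp (-(1/2) * x ^ 2) + 2 ^ n * n.factorial *
              (Real.exp (1/2 * x ^ 2) * Real.exp (-(1/2) * x ^ 2)) := by ring
        _ ≤ _ := by rw [h3, mul_one]; gcongr
    induction P using Polynomial.induction_on' with
    | add P Q hP hQ =>
      obtain ⟨C, hC⟩ := hP
      obtain ⟨C', hC'⟩ := hQ
      refine ⟨C + C', fun x => ?_⟩
      refine le_trans ?_ (add_le_add (hC x) (hC' x))
      beta_reduce
      rw [Polynomial.eval_add, add_mul, ← mul_add]
      gcongr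
      exact norm_add_le _ _
    | monomial n a =>
      obtain ⟨C, hC⟩ := key (m + n)
      refine ⟨‖a‖ * C, fun x => ?_⟩
      beta_reduce
      rw [Polynomial.eval_monomial, norm_mul, norm_mul, norm_pow, Complex.norm_real,
        Real.norm_eq_abs]
      calc _ = ‖a‖ * (|x| ^ (m + n) * ‖cexp (-(1/2) * (x : ℂ) ^ 2)‖) := by ring
        _ ≤ _ := by gcongr; exact hC x

/-- The Dunkl operator preserves the Schwartz space. -/
lemma exists_schwartzMap_dunklOp (k : ℝ) (f : 𝓢(ℝ, ℂ)) :
    ∃ g : 𝓢(ℝ, ℂ), ⇑g = dunklOp k f := by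
  obtain ⟨h, hh⟩ := (f - reflX f).exists_eq_sub_mul (x₀ := 0) (by simp)
  refine ⟨derivX f + ((2 * k + 1) / 2 : ℂ) • h, funext fun x => ?_⟩
  simp only [sub_apply, reflX_apply, ofReal_zero, sub_zero] at hh
  simp only [add_apply, smul_apply, derivX_apply, smul_eq_mul, dunklOp]
  split_ifs with hx
  · subst hx
    have h1 : HasDerivAt (fun x : ℝ => (x : ℂ) * h x) (h 0) 0 := by
      refine ((Complex.ofRealCLM.hasDerivAt (x := (0 : ℝ))).mul
        (h.differentiable_real 0).hasDerivAt).congr_deriv ?_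
      simp
    have h2 : HasDerivAt (fun x : ℝ => f x - f (-x)) (deriv f 0 + deriv f 0) 0 := by
      have h3 : HasDerivAt f (deriv f 0) (-0) := by
        rw [neg_zero]; exact (f.differentiable_real 0).hasDerivAt
      refine ((f.differentiable_real 0).hasDerivAt.sub
        (h3.scomp 0 (hasDerivAt_neg (0 : ℝ)))).congr_deriv ?_
      simp
    rw [funext hh] at h2
    rw [h1.unique h2]
    ring
  · have hx' : (x : ℂ) ≠ 0 := by exact_mod_cast hx
    rw [hh x]
    push_cast
    field_simp

/-- The Dunkl operator on the Schwartz space. -/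
noncomputable def dunklS (k : ℝ) (f : 𝓢(ℝ, ℂ)) : 𝓢(ℝ, ℂ) := (exists_schwartzMap_dunklOp k f).choose

lemma coe_dunklS (k : ℝ) (f : 𝓢(ℝ, ℂ)) : ⇑(dunklS k f) = dunklOp k f :=
  (exists_schwartzMap_dunklOp k f).choose_spec

lemma coe_iterate_dunklS (k : ℝ) (f : 𝓢(ℝ, ℂ)) (n : ℕ) :
    ⇑((dunklS k)^[n] f) = (dunklOp k)^[n] f := by
  induction n with
  | zero => rfl
  | succ n ih => rw [Function.iterate_succ_apply', Function.iterate_succ_apply', coe_dunklS, ih]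

/-- The density of `muK k` with respect to Lebesgue measure. -/
noncomputable def wK (k x : ℝ) : ℝ := |x| ^ (2 * k + 1) / (2 ^ (k + 1) * Real.Gamma (k + 1))

lemma wK_const_pos {k : ℝ} (hk : -(1/2) ≤ k) : 0 < 2 ^ (k + 1) * Real.Gamma (k + 1) :=
  mul_pos (by positivity) (Real.Gamma_pos_of_pos (by linarith))

lemma wK_nonneg {k : ℝ} (hk : -(1/2) ≤ k) (x : ℝ) : 0 ≤ wK k x :=
  div_nonneg (by positivity) (wK_const_pos hk).le

lemma wK_neg (k x : ℝ) : wK k (-x) = wK k x := by simp [wK]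

lemma continuous_wK {k : ℝ} (hk : -(1/2) ≤ k) : Continuous (wK k) :=
  (continuous_abs.rpow_const fun _ => Or.inr (by linarith)).div_const _

lemma muK_eq (k : ℝ) : muK k = volume.withDensity fun x => ENNReal.ofReal (wK k x) := rfl

lemma integral_muK {k : ℝ} (hk : -(1/2) ≤ k) (f : ℝ → ℂ) :
    ∫ x, f x ∂(muK k) = ∫ x, (wK k x : ℂ) * f x := by
  rw [muK_eq, integral_withDensity_eq_integral_toReal_smul
    (continuous_wK hk).measurable.ennreal_ofReal (by simp)]
  simp only [ENNReal.toReal_ofReal (wK_nonneg hk _), Complex.real_smul]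

lemma integrable_muK_iff {k : ℝ} (hk : -(1/2) ≤ k) {f : ℝ → ℂ} :
    Integrable f (muK k) ↔ Integrable fun x => (wK k x : ℂ) * f x := by
  rw [muK_eq, integrable_withDensity_iff_integrable_smul'
    (continuous_wK hk).measurable.ennreal_ofReal (by simp)]
  simp only [ENNReal.toReal_ofReal (wK_nonneg hk _), Complex.real_smul]

lemma muK_hasTemperateGrowth {k : ℝ} (hk : -(1/2) ≤ k) : (muK k).HasTemperateGrowth := by
  refine ⟨⌈2 * k + 1⌉₊ + 2, ?_⟩
  rw [muK_eq, integrable_withDensity_iff_integrable_smul'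
    (continuous_wK hk).measurable.ennreal_ofReal (by simp)]
  simp only [ENNReal.toReal_ofReal (wK_nonneg hk _)]
  have h2 : Integrable (fun x : ℝ => (1 + ‖x‖) ^ (-(2 : ℝ))) :=
    integrable_one_add_norm (by simp)
  refine (h2.const_mul (2 ^ (k + 1) * Real.Gamma (k + 1))⁻¹).mono' ?_
    (Eventually.of_forall fun x => ?_)
  · have := (continuous_wK hk).measurable
    exact Measurable.aestronglyMeasurable (by fun_prop)
  · have hx : (1 : ℝ) ≤ 1 + |x| := by linarith [abs_nonneg x]
    have h0 := wK_const_pos hk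
    rw [smul_eq_mul, norm_mul, Real.norm_of_nonneg (wK_nonneg hk x), Real.norm_of_nonneg
      (by positivity), Real.norm_eq_abs]
    have h3 : |x| ^ (2 * k + 1) ≤ (1 + |x|) ^ ((⌈2 * k + 1⌉₊ : ℕ) : ℝ) :=
      (Real.rpow_le_rpow (abs_nonneg x) (by linarith) (by linarith)).trans
        (Real.rpow_le_rpow_of_exponent_le hx (Nat.le_ceil _))
    calc wK k x * (1 + |x|) ^ (-((⌈2 * k + 1⌉₊ + 2 : ℕ) : ℝ))
        ≤ (1 + |x|) ^ ((⌈2 * k + 1⌉₊ : ℕ) : ℝ) / (2 ^ (k + 1) * Real.Gamma (k + 1)) *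
          (1 + |x|) ^ (-((⌈2 * k + 1⌉₊ + 2 : ℕ) : ℝ)) := by
          rw [wK]
          gcongr
      _ = (2 ^ (k + 1) * Real.Gamma (k + 1))⁻¹ * ((1 + |x|) ^ ((⌈2 * k + 1⌉₊ : ℕ) : ℝ) *
          (1 + |x|) ^ (-((⌈2 * k + 1⌉₊ + 2 : ℕ) : ℝ))) := by ring
      _ = _ := by
          rw [← Real.rpow_add (by linarith)]
          congr 2
          push_cast
          ring

/-- A function decaying faster than every power. -/
def RapidDecay (u : ℝ → ℂ) : Prop := ∀ m : ℕ, ∃ C : ℝ, ∀ x : ℝ, |x| ^ m * ‖u x‖ ≤ C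

lemma SchwartzMap.rapidDecay (f : 𝓢(ℝ, ℂ)) : RapidDecay f := fun m => by
  obtain ⟨C, -, hC⟩ := f.decay m 0
  exact ⟨C, fun x => by simpa using hC x⟩

lemma RapidDecay.mul_bounded {u v : ℝ → ℂ} (hu : RapidDecay u) {B : ℝ} (hv : ∀ x, ‖v x‖ ≤ B) :
    RapidDecay fun x => u x * v x := fun m => by
  obtain ⟨C, hC⟩ := hu m
  refine ⟨C * B, fun x => ?_⟩
  rw [norm_mul, ← mul_assoc]
  exact mul_le_mul (hC x) (hv x) (norm_nonneg _)
    ((mul_nonneg (by positivity) (norm_nonneg _)).trans (hC x))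

lemma RapidDecay.integrable {k : ℝ} (hk : -(1/2) ≤ k) {u : ℝ → ℂ} (hu : RapidDecay u)
    (hm : Measurable u) : Integrable u (muK k) := by
  have := muK_hasTemperateGrowth hk
  obtain ⟨C₁, hC₁⟩ := hu 0
  obtain ⟨C₂, hC₂⟩ := hu (0 + (muK k).integrablePower)
  have := integrable_of_le_of_pow_mul_le (μ := muK k) (k := 0) (f := u) (C₁ := C₁)
    (fun x => by simpa using hC₁ x) hC₂ hm.aestronglyMeasurable
  simp only [pow_zero, one_mul] at this
  exact (integrable_norm_iff hm.aestronglyMeasurable).mp this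

lemma RapidDecay.tendsto_wK_mul {k : ℝ} (hk : -(1/2) ≤ k) {u : ℝ → ℂ} (hu : RapidDecay u) :
    Tendsto (fun x => (wK k x : ℂ) * u x) atTop (𝓝 0) := by
  obtain ⟨C, hC⟩ := hu (⌈2 * k + 1⌉₊ + 1)
  refine squeeze_zero_norm' (a := fun x => (C / (2 ^ (k + 1) * Real.Gamma (k + 1))) / x) ?_
    (tendsto_const_nhds.div_atTop tendsto_id)
  filter_upwards [eventually_ge_atTop 1] with x hx
  have hx0 : 0 < x := by linarith
  have h0 := wK_const_pos hk
  have h1 := hC x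
  rw [abs_of_pos hx0] at h1
  rw [norm_mul, Complex.norm_real, Real.norm_of_nonneg (wK_nonneg hk x), wK, abs_of_pos hx0,
    le_div_iff₀ hx0, div_mul_eq_mul_div, div_mul_eq_mul_div]
  gcongr
  calc x ^ (2 * k + 1) * ‖u x‖ * x ≤ x ^ ((⌈2 * k + 1⌉₊ : ℕ) : ℝ) * ‖u x‖ * x := by
        gcongr
        exact Nat.le_ceil _
    _ = x ^ (⌈2 * k + 1⌉₊ + 1) * ‖u x‖ := by
        rw [Real.rpow_natCast]; ring
    _ ≤ C := h1

lemma RapidDecay.comp_neg {u : ℝ → ℂ} (hu : RapidDecay u) : RapidDecay fun x => u (-x) :=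
  fun m => by
    obtain ⟨C, hC⟩ := hu m
    exact ⟨C, fun x => by simpa using hC (-x)⟩

lemma measurable_dunklOp (k : ℝ) {u : ℝ → ℂ} (hu : Measurable u) : Measurable (dunklOp k u) := by
  unfold dunklOp
  refine Measurable.ite (measurableSet_singleton 0) measurable_const ?_
  have := measurable_deriv u
  fun_prop

lemma hasDerivAt_wK (k : ℝ) {x : ℝ} (hx : 0 < x) :
    HasDerivAt (fun x => (wK k x : ℂ)) (((2 * k + 1) / x * wK k x : ℝ) : ℂ) x := by
  have h1 : HasDerivAt (wK k) ((2 * k + 1) / x * wK k x) x := by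
    have h2 := (Real.hasDerivAt_rpow_const (p := 2 * k + 1) (Or.inl hx.ne')).div_const
      (2 ^ (k + 1) * Real.Gamma (k + 1))
    have h3 : wK k =ᶠ[𝓝 x] fun x => x ^ (2 * k + 1) / (2 ^ (k + 1) * Real.Gamma (k + 1)) := by
      filter_upwards [eventually_gt_nhds hx] with y hy
      rw [wK, abs_of_pos hy]
    refine (h2.congr_of_eventuallyEq h3).congr_deriv ?_
    rw [wK, abs_of_pos hx, Real.rpow_sub_one hx.ne']
    ring
  exact h1.ofReal_comp

/-- The Dunkl operator is skew-symmetric. -/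
lemma integral_dunklOp_mul {k : ℝ} (hk : -(1/2) ≤ k) {u v : ℝ → ℂ} (hu : Differentiable ℝ u)
    (hv : Differentiable ℝ v) (hud : RapidDecay u) (hud' : RapidDecay (dunklOp k u)) {B B' : ℝ}
    (hvb : ∀ x, ‖v x‖ ≤ B) (hvb' : ∀ x, ‖dunklOp k v x‖ ≤ B') :
    ∫ x, dunklOp k u x * v x ∂(muK k) = -∫ x, u x * dunklOp k v x ∂(muK k) := by
  have hum := hu.continuous.measurable
  have hvm := hv.continuous.measurable
  have i1 : Integrable (fun x => dunklOp k u x * v x) (muK k) :=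
    (hud'.mul_bounded hvb).integrable hk ((measurable_dunklOp k hum).mul hvm)
  have i2 : Integrable (fun x => u x * dunklOp k v x) (muK k) :=
    (hud.mul_bounded hvb').integrable hk (hum.mul (measurable_dunklOp k hvm))
  rw [eq_neg_iff_add_eq_zero, ← integral_add i1 i2, integral_muK hk]
  set F : ℝ → ℂ := fun x => (wK k x : ℂ) * (dunklOp k u x * v x + u x * dunklOp k v x) with hF
  have hFi : Integrable F := (integrable_muK_iff hk).mp (i1.add i2)
  have hsplit : ∫ x, F x = ∫ x in Set.Ioi (0:ℝ), (F x + F (-x)) := by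
    rw [integral_add hFi.integrableOn hFi.comp_neg.integrableOn, integral_comp_neg_Ioi, neg_zero,
      add_comm, ← Set.compl_Iic, integral_add_compl measurableSet_Iic hFi]
  rw [hsplit]
  set P : ℝ → ℂ := fun x => u x * v x with hP
  have hPd : RapidDecay P := hud.mul_bounded hvb
  have hPc : Continuous P := hu.continuous.mul hv.continuous
  have hw := continuous_wK hk
  have := integral_Ioi_of_hasDerivAt_of_tendsto (a := 0) (m := 0)
    (f := fun x => (wK k x : ℂ) * (P x - P (-x))) (f' := fun x => F x + F (-x))
    (Continuous.continuousWithinAt (by fun_prop)) ?_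
    (hFi.integrableOn.add hFi.comp_neg.integrableOn) ?_
  · rw [this]; simp
  · intro x hx
    have hx' : (x : ℂ) ≠ 0 := by exact_mod_cast (ne_of_gt hx)
    have hx0 : x ≠ 0 := ne_of_gt hx
    have d1 := (hu x).hasDerivAt.mul (hv x).hasDerivAt
    have d2 := ((hu (-x)).hasDerivAt.mul (hv (-x)).hasDerivAt).scomp x (hasDerivAt_neg x)
    refine ((hasDerivAt_wK k hx).mul (d1.sub d2)).congr_deriv ?_
    simp only [hF, dunklOp, hx0, neg_eq_zero, if_false, wK_neg, neg_neg, Pi.sub_apply,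
      Pi.mul_apply, Function.comp_apply]
    push_cast
    simp only [neg_smul, one_smul]
    field_simp
    ring
  · have h1 := hPd.tendsto_wK_mul hk
    have h2 := hPd.comp_neg.tendsto_wK_mul hk
    simpa [mul_sub] using h1.sub h2

lemma dunklT_eq (k : ℝ) (f : ℝ → ℂ) (lam : ℝ) :
    dunklT k f lam = ∫ x, f x * dunklE k (-lam * x) ∂(muK k) := by
  simp only [dunklT, dunklKernel_eq]

lemma differentiable_dunklE_mul {k : ℝ} (hk : -(1/2) ≤ k) (lam : ℝ) :
    Differentiable ℝ fun x => dunklE k (lam * x) := fun x =>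
  (hasDerivAt_dunklE_mul hk lam x).differentiableAt

lemma norm_dunklOp_dunklE_le {k : ℝ} (hk : -(1/2) ≤ k) (lam x : ℝ) :
    ‖dunklOp k (fun x => dunklE k (lam * x)) x‖ ≤ |lam| := by
  rw [dunklOp_dunklE hk, norm_mul, norm_mul, Complex.norm_I, one_mul, Complex.norm_real]
  exact mul_le_of_le_one_right (abs_nonneg _) (norm_dunklE_le_one hk _)

lemma SchwartzMap.integrable_muK {k : ℝ} (hk : -(1/2) ≤ k) (f : 𝓢(ℝ, ℂ)) :
    Integrable f (muK k) :=
  f.rapidDecay.integrable hk f.continuous.measurable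

lemma integrable_mul_dunklE {k : ℝ} (hk : -(1/2) ≤ k) {f : ℝ → ℂ} (hf : Integrable f (muK k))
    (lam : ℝ) : Integrable (fun x => f x * dunklE k (lam * x)) (muK k) :=
  hf.mul_bdd (c := 1)
    ((differentiable_dunklE_mul hk lam).continuous.aestronglyMeasurable)
    (Eventually.of_forall fun _ => norm_dunklE_le_one hk _)

/-- The Dunkl transform intertwines the Dunkl operator and multiplication by `iλ`. -/
lemma dunklT_dunklS {k : ℝ} (hk : -(1/2) ≤ k) (h : 𝓢(ℝ, ℂ)) (lam : ℝ) :
    dunklT k (dunklS k h) lam = I * lam * dunklT k h lam := by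
  rw [dunklT_eq, dunklT_eq, coe_dunklS, integral_dunklOp_mul hk h.differentiable_real
    (differentiable_dunklE_mul hk _) h.rapidDecay (by rw [← coe_dunklS]; exact (dunklS k h).rapidDecay)
    (fun x => norm_dunklE_le_one hk _) (fun x => norm_dunklOp_dunklE_le hk _ x),
    ← integral_neg, ← integral_const_mul]
  congr 1
  funext x
  rw [dunklOp_dunklE hk]
  push_cast
  ring

lemma dunklT_iterate_dunklS {k : ℝ} (hk : -(1/2) ≤ k) (h : 𝓢(ℝ, ℂ)) (n : ℕ) (lam : ℝ) :
    dunklT k ((dunklS k)^[n] h) lam = (I * lam) ^ n * dunklT k h lam := by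
  induction n with
  | zero => simp
  | succ n ih =>
    rw [Function.iterate_succ_apply', dunklT_dunklS hk, ih]
    ring

lemma norm_dunklT_le {k : ℝ} (hk : -(1/2) ≤ k) (h : 𝓢(ℝ, ℂ)) (lam : ℝ) :
    ‖dunklT k h lam‖ ≤ ∫ x, ‖h x‖ ∂(muK k) := by
  rw [dunklT_eq]
  refine norm_integral_le_of_norm_le (h.integrable_muK hk).norm (Eventually.of_forall fun x => ?_)
  rw [norm_mul]
  exact mul_le_of_le_one_right (norm_nonneg _) (norm_dunklE_le_one hk _)

lemma rapidDecay_dunklT {k : ℝ} (hk : -(1/2) ≤ k) (h : 𝓢(ℝ, ℂ)) : RapidDecay (dunklT k h) :=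
  fun m => by
    refine ⟨∫ x, ‖((dunklS k)^[m] h) x‖ ∂(muK k), fun lam => ?_⟩
    have := norm_dunklT_le hk ((dunklS k)^[m] h) lam
    rwa [dunklT_iterate_dunklS hk, norm_mul, norm_pow, norm_mul, Complex.norm_I, one_mul,
      Complex.norm_real] at this

lemma hasDerivAt_dunklT {k : ℝ} (hk : -(1/2) ≤ k) (h : 𝓢(ℝ, ℂ)) (lam : ℝ) :
    Integrable (fun x => h x * (((-x : ℝ) : ℂ) * dunklE' k (-x * lam))) (muK k) ∧
    HasDerivAt (dunklT k h) (∫ x, h x * (((-x : ℝ) : ℂ) * dunklE' k (-x * lam)) ∂(muK k)) lam := by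
  have hE := continuous_dunklE hk
  have hE' := continuous_dunklE' hk
  have hc := h.continuous
  have := hasDerivAt_integral_of_dominated_loc_of_deriv_le (μ := muK k) (x₀ := lam)
    (F := fun lam x => h x * dunklE k (-x * lam))
    (F' := fun lam x => h x * (((-x : ℝ) : ℂ) * dunklE' k (-x * lam)))
    (bound := fun x => ‖mulX h x‖ * 3) univ_mem
    (Eventually.of_forall fun y => Continuous.aestronglyMeasurable (by fun_prop)) ?_
    (Continuous.aestronglyMeasurable (by fun_prop)) (Eventually.of_forall fun x y _ => ?_)
    (((mulX h).integrable_muK hk).norm.mul_const 3)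
    (Eventually.of_forall fun x y _ => (hasDerivAt_dunklE_mul hk (-x) y).const_mul (h x))
  · refine ⟨this.1, this.2.congr_of_eventuallyEq (Eventually.of_forall fun y => ?_)⟩
    simp only [dunklT_eq]
    congr 1
    funext x
    ring_nf
  · convert integrable_mul_dunklE hk (h.integrable_muK hk) (-lam) using 3 with x
    ring_nf
  · rw [mulX_apply, norm_mul, norm_mul, norm_mul, Complex.norm_real, Complex.norm_real, norm_neg]
    calc _ = ‖x‖ * ‖h x‖ * ‖dunklE' k (-x * y)‖ := by ring
      _ ≤ _ := by gcongr; exact norm_dunklE'_le hk _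

lemma differentiable_dunklT {k : ℝ} (hk : -(1/2) ≤ k) (h : 𝓢(ℝ, ℂ)) :
    Differentiable ℝ (dunklT k h) := fun lam => (hasDerivAt_dunklT hk h lam).2.differentiableAt

/-- The Dunkl transform intertwines multiplication by `-ix` and the Dunkl operator. -/
lemma dunklOp_dunklT {k : ℝ} (hk : -(1/2) ≤ k) (h : 𝓢(ℝ, ℂ)) (lam : ℝ) :
    dunklOp k (dunklT k h) lam = -I * dunklT k (mulX h) lam := by
  have key : ∀ x : ℝ, h x * dunklOp k (fun lam => dunklE k (-x * lam)) lam =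
      -I * (mulX h x * dunklE k (-lam * x)) := fun x => by
    rw [dunklOp_dunklE hk, mulX_apply]
    push_cast
    ring_nf
  obtain ⟨hi, hd⟩ := hasDerivAt_dunklT hk h lam
  rw [dunklT_eq k (mulX h), ← integral_const_mul]
  simp only [← key]
  unfold dunklOp
  split_ifs with hl
  · subst hl
    rw [hd.deriv, ← integral_const_mul]
    congr 1
    funext x
    rw [(hasDerivAt_dunklE_mul hk (-x) 0).deriv]
    ring
  · have i1 := integrable_mul_dunklE hk (h.integrable_muK hk) (-lam)
    have i2 := integrable_mul_dunklE hk (h.integrable_muK hk) (- -lam)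
    rw [hd.deriv, dunklT_eq, dunklT_eq, ← integral_sub i1 i2, ← integral_div, ← integral_const_mul,
      ← integral_add hi (by exact ((i1.sub i2).div_const 2).const_mul _)]
    congr 1
    funext x
    rw [(hasDerivAt_dunklE_mul hk (-x) lam).deriv]
    push_cast
    ring_nf

/-- The Gaussian `exp(-x²/2)` as a Schwartz function. -/
noncomputable def gaussS : 𝓢(ℝ, ℂ) := exists_schwartzMap_gaussian.choose

lemma gaussS_apply (x : ℝ) : gaussS x = cexp (-(1/2) * (x : ℂ) ^ 2) :=
  exists_schwartzMap_gaussian.choose_spec x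

lemma gaussS_neg (x : ℝ) : gaussS (-x) = gaussS x := by
  simp [gaussS_apply]

lemma gaussS_ne_zero (x : ℝ) : gaussS x ≠ 0 := by
  rw [gaussS_apply]; exact Complex.exp_ne_zero _

lemma hasDerivAt_gaussS (x : ℝ) : HasDerivAt gaussS (-x * gaussS x) x := by
  rw [gaussS_apply, show (gaussS : ℝ → ℂ) = fun x : ℝ => cexp (-(1/2) * (x : ℂ) ^ 2) from
    funext gaussS_apply]
  refine (hasDerivAt_exp_mul_sq (-(1/2)) x).congr_deriv ?_
  ring

lemma dunklS_gaussS (k : ℝ) : dunklS k gaussS = -mulX gaussS := by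
  ext x
  rw [coe_dunklS, neg_apply, mulX_apply, dunklOp]
  split_ifs with hx
  · subst hx
    rw [(hasDerivAt_gaussS 0).deriv]
    simp
  · rw [(hasDerivAt_gaussS x).deriv, gaussS_neg]
    simp

lemma integral_comp_neg_muK {k : ℝ} (hk : -(1/2) ≤ k) (f : ℝ → ℂ) :
    ∫ x, f (-x) ∂(muK k) = ∫ x, f x ∂(muK k) := by
  rw [integral_muK hk, integral_muK hk, ← integral_neg_eq_self]
  simp only [neg_neg, wK_neg]

/-- The value at `0` of the Dunkl transform of the Gaussian. -/
noncomputable def gaussC (k : ℝ) : ℂ := dunklT k gaussS 0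

lemma gaussC_ne_zero {k : ℝ} (hk : -(1/2) ≤ k) : gaussC k ≠ 0 := by
  have hw := continuous_wK hk
  have hi := (integrable_muK_iff hk).mp (gaussS.integrable_muK hk)
  have hR : (fun x => (wK k x : ℂ) * gaussS x) =
      fun x => ((wK k x * Real.exp (-(1/2) * x ^ 2) : ℝ) : ℂ) := by
    funext x
    rw [gaussS_apply, cexp_neg_half_sq, ofReal_mul]
  have : gaussC k = ((∫ x, wK k x * Real.exp (-(1/2) * x ^ 2) : ℝ) : ℂ) := by
    rw [gaussC, dunklT_eq]
    simp only [neg_zero, zero_mul, dunklE_zero hk, mul_one]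
    rw [integral_muK hk, hR]
    exact integral_ofReal
  rw [this]
  rw [hR] at hi
  replace hi := hi.re
  simp only [RCLike.re_eq_complex_re, ofReal_re] at hi
  refine ofReal_ne_zero.mpr (ne_of_gt (integral_pos_of_integrable_nonneg_nonzero (x := 1)
    (by fun_prop) hi (fun x => mul_nonneg (wK_nonneg hk x) (Real.exp_nonneg _))
    (mul_ne_zero ?_ (Real.exp_pos _).ne')))
  rw [wK, abs_one, Real.one_rpow]
  exact (one_div_pos.mpr (wK_const_pos hk)).ne'

lemma dunklT_neg_even {k : ℝ} (hk : -(1/2) ≤ k) {h : ℝ → ℂ} (he : ∀ x, h (-x) = h x) (lam : ℝ) :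
    dunklT k h (-lam) = dunklT k h lam := by
  rw [dunklT_eq, dunklT_eq, ← integral_comp_neg_muK hk]
  simp only [he, neg_neg, mul_neg, neg_mul]

/-- The Gaussian is an eigenfunction of the Dunkl transform. -/
lemma dunklT_gaussS {k : ℝ} (hk : -(1/2) ≤ k) (lam : ℝ) :
    dunklT k gaussS lam = gaussC k * gaussS lam := by
  set D := dunklT k gaussS with hD
  have hkc : (2 * (k : ℂ) + 2) ≠ 0 := by
    norm_cast; linarith
  have hder : ∀ l : ℝ, HasDerivAt D (-l * D l) l := fun l => by
    refine (differentiable_dunklT hk gaussS l).hasDerivAt.congr_deriv ?_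
    have h1 : dunklOp k D l = -l * D l := by
      rw [dunklOp_dunklT hk, show mulX gaussS = -dunklS k gaussS by rw [dunklS_gaussS, neg_neg]]
      have : dunklT k ⇑(-dunklS k gaussS) l = -dunklT k (dunklS k gaussS) l := by
        simp only [dunklT_eq, neg_apply, neg_mul, integral_neg]
      rw [this, dunklT_dunklS hk, ← hD]
      linear_combination (l * D l) * Complex.I_mul_I
    rw [dunklOp] at h1
    split_ifs at h1 with hl
    · subst hl
      simp only [ofReal_zero, neg_zero, zero_mul, mul_eq_zero, hkc, false_or] at h1 ⊢
      exact h1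
    · rw [hD, dunklT_neg_even hk gaussS_neg, sub_self, zero_div, mul_zero, add_zero] at h1
      exact h1
  have hq : ∀ l : ℝ, HasDerivAt (fun l : ℝ => D l * cexp (1/2 * (l : ℂ) ^ 2)) 0 l := fun l => by
    refine ((hder l).mul (hasDerivAt_exp_mul_sq (1/2) l)).congr_deriv ?_
    ring
  have hconst := is_const_of_deriv_eq_zero (fun l => (hq l).differentiableAt)
    (fun l => (hq l).deriv) lam 0
  simp only [ofReal_zero, ne_eq, OfNat.ofNat_ne_zero, not_false_eq_true, zero_pow, mul_zero,
    Complex.exp_zero, mul_one] at hconst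
  rw [gaussC, ← hD, ← hconst, gaussS_apply, mul_assoc, ← Complex.exp_add]
  simp

lemma dunklT_sub {k : ℝ} (hk : -(1/2) ≤ k) (f g : 𝓢(ℝ, ℂ)) (lam : ℝ) :
    dunklT k ⇑(f - g) lam = dunklT k f lam - dunklT k g lam := by
  rw [dunklT_eq, dunklT_eq, dunklT_eq, ← integral_sub
    (integrable_mul_dunklE hk (f.integrable_muK hk) _)
    (integrable_mul_dunklE hk (g.integrable_muK hk) _)]
  simp only [sub_apply, sub_mul]

lemma dunklT_smul (k : ℝ) (z : ℂ) (f : 𝓢(ℝ, ℂ)) (lam : ℝ) :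
    dunklT k ⇑(z • f) lam = z * dunklT k f lam := by
  rw [dunklT_eq, dunklT_eq, ← integral_const_mul]
  simp only [smul_apply, smul_eq_mul, mul_assoc]

lemma integrable_dunklT {k : ℝ} (hk : -(1/2) ≤ k) (h : 𝓢(ℝ, ℂ)) :
    Integrable (dunklT k h) (muK k) :=
  (rapidDecay_dunklT hk h).integrable hk (differentiable_dunklT hk h).continuous.measurable

lemma dunklT_mulX {k : ℝ} (hk : -(1/2) ≤ k) (h : 𝓢(ℝ, ℂ)) (lam : ℝ) :
    dunklT k (mulX h) lam = I * dunklOp k (dunklT k h) lam := by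
  rw [dunklOp_dunklT hk]
  linear_combination (dunklT k (mulX h) lam) * Complex.I_mul_I

lemma integral_dunklT_sub_mul {k : ℝ} (hk : -(1/2) ≤ k) (h : 𝓢(ℝ, ℂ)) (x₀ : ℝ) :
    ∫ lam, dunklT k ⇑(mulX h - (x₀ : ℂ) • h) lam * dunklE k (x₀ * lam) ∂(muK k) = 0 := by
  have hrd : RapidDecay (dunklOp k (dunklT k h)) := by
    have := (rapidDecay_dunklT hk (mulX h)).mul_bounded (v := fun _ => -I) (B := 1) (by simp)
    convert this using 1
    funext lam
    rw [dunklOp_dunklT hk, mul_comm]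
  have hibp := integral_dunklOp_mul hk (differentiable_dunklT hk h)
    (differentiable_dunklE_mul hk x₀) (rapidDecay_dunklT hk h) hrd
    (fun x => norm_dunklE_le_one hk _) (fun x => norm_dunklOp_dunklE_le hk _ x)
  have i1 := (integrable_mul_dunklE hk (integrable_dunklT hk (mulX h)) x₀)
  have i2 := (integrable_mul_dunklE hk (integrable_dunklT hk h) x₀).const_mul (x₀ : ℂ)
  have e1 : ∫ lam, dunklT k (mulX h) lam * dunklE k (x₀ * lam) ∂(muK k) =
      I * ∫ lam, dunklOp k (dunklT k h) lam * dunklE k (x₀ * lam) ∂(muK k) := by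
    rw [← integral_const_mul]
    simp only [dunklT_mulX hk, mul_assoc]
  have e2 : ∫ lam, dunklT k h lam * dunklOp k (fun x => dunklE k (x₀ * x)) lam ∂(muK k) =
      I * x₀ * ∫ lam, dunklT k h lam * dunklE k (x₀ * lam) ∂(muK k) := by
    rw [← integral_const_mul]
    congr 1
    funext lam
    rw [dunklOp_dunklE hk]
    ring
  simp only [dunklT_sub hk, dunklT_smul, sub_mul, mul_assoc]
  rw [integral_sub i1 i2, e1, hibp, e2, integral_const_mul]
  linear_combination (-(x₀ : ℂ) * ∫ lam, dunklT k h lam * dunklE k (x₀ * lam) ∂(muK k)) *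
    Complex.I_mul_I

/-- The inversion formula for the Dunkl transform, up to the value of the constant. -/
lemma integral_dunklT_mul_dunklE {k : ℝ} (hk : -(1/2) ≤ k) (f : 𝓢(ℝ, ℂ)) (x₀ : ℝ) :
    ∫ lam, dunklT k f lam * dunklE k (x₀ * lam) ∂(muK k) = gaussC k ^ 2 * f x₀ := by
  set α : ℂ := f x₀ / gaussS x₀ with hα
  have h0 : (f - α • gaussS) x₀ = 0 := by
    simp [hα, gaussS_ne_zero]
  obtain ⟨h, hh⟩ := (f - α • gaussS).exists_eq_sub_mul h0
  have hf : mulX h - (x₀ : ℂ) • h = f - α • gaussS := by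
    ext x
    rw [hh x]
    simp only [sub_apply, smul_apply, mulX_apply, smul_eq_mul]
    ring
  have key := integral_dunklT_sub_mul hk h x₀
  rw [hf] at key
  have i1 := integrable_mul_dunklE hk (integrable_dunklT hk f) x₀
  have i2 := (integrable_mul_dunklE hk (integrable_dunklT hk gaussS) x₀).const_mul α
  simp only [dunklT_sub hk, dunklT_smul, sub_mul, mul_assoc] at key
  rw [integral_sub i1 i2, integral_const_mul, sub_eq_zero] at key
  have hG : ∫ lam, dunklT k gaussS lam * dunklE k (x₀ * lam) ∂(muK k) =
      gaussC k ^ 2 * gaussS x₀ := by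
    have h1 : dunklT k gaussS (-x₀) = ∫ lam, gaussS lam * dunklE k (x₀ * lam) ∂(muK k) := by
      rw [dunklT_eq, neg_neg]
    simp only [dunklT_gaussS hk, mul_assoc]
    rw [integral_const_mul, ← h1, dunklT_gaussS hk, gaussS_neg]
    ring
  rw [key, hG, hα]
  field_simp [gaussS_ne_zero x₀]

/-- Parseval's formula for the Dunkl transform, up to the value of the constant. -/
lemma integral_dunklT_mul_conj {k : ℝ} (hk : -(1/2) ≤ k) (h φ : 𝓢(ℝ, ℂ)) :
    ∫ lam, dunklT k h lam * (starRingEnd ℂ) (dunklT k φ lam) ∂(muK k) =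
      gaussC k ^ 2 * ∫ x, h x * (starRingEnd ℂ) (φ x) ∂(muK k) := by
  have : SFinite (muK k) := by rw [muK_eq]; infer_instance
  have h1 : ∀ lam, (starRingEnd ℂ) (dunklT k φ lam) =
      ∫ x, (starRingEnd ℂ) (φ x) * dunklE k (x * lam) ∂(muK k) := fun lam => by
    rw [dunklT_eq, ← integral_conj]
    congr 1
    funext x
    rw [map_mul, conj_dunklE]
    ring_nf
  have hconj : Integrable (fun x => (starRingEnd ℂ) (φ x)) (muK k) :=
    Complex.conjCLE.toContinuousLinearMap.integrable_comp (φ.integrable_muK hk)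
  have hE := continuous_dunklE hk
  have hint : Integrable (Function.uncurry fun lam x : ℝ =>
      dunklT k h lam * ((starRingEnd ℂ) (φ x) * dunklE k (x * lam))) ((muK k).prod (muK k)) := by
    have := ((integrable_dunklT hk h).mul_prod hconj).mul_bdd (c := 1)
      (g := fun z : ℝ × ℝ => dunklE k (z.2 * z.1))
      (Continuous.aestronglyMeasurable (by fun_prop))
      (Eventually.of_forall fun _ => norm_dunklE_le_one hk _)
    refine this.congr (Eventually.of_forall fun z => ?_)
    simp only [Function.uncurry]
    ring
  simp only [h1, ← integral_const_mul]
  rw [integral_integral_swap hint]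
  congr 1
  funext x
  calc _ = ∫ lam, (starRingEnd ℂ) (φ x) * (dunklT k h lam * dunklE k (x * lam)) ∂(muK k) := by
        congr 1; funext lam; ring
    _ = _ := by
        rw [integral_const_mul, integral_dunklT_mul_dunklE hk]
        ring

lemma dunklS_add (k : ℝ) (f g : 𝓢(ℝ, ℂ)) : dunklS k (f + g) = dunklS k f + dunklS k g := by
  ext x
  have hd : ∀ x, deriv ⇑(f + g) x = deriv f x + deriv g x := fun x =>
    deriv_add (f.differentiable_real x) (g.differentiable_real x)
  rw [add_apply, coe_dunklS, coe_dunklS, coe_dunklS]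
  simp only [dunklOp, hd, add_apply]
  split_ifs <;> ring

lemma dunklS_smul (k : ℝ) (z : ℂ) (f : 𝓢(ℝ, ℂ)) : dunklS k (z • f) = z • dunklS k f := by
  ext x
  have hd : ∀ x, deriv ⇑(z • f) x = z * deriv f x := fun x =>
    deriv_const_mul z (f.differentiable_real x)
  rw [smul_apply, coe_dunklS, coe_dunklS]
  simp only [dunklOp, hd, smul_apply, smul_eq_mul]
  split_ifs <;> ring

lemma dunklS_reflX (k : ℝ) (f : 𝓢(ℝ, ℂ)) : dunklS k (reflX f) = -reflX (dunklS k f) := by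
  ext x
  have hd : ∀ x, deriv ⇑(reflX f) x = -deriv f (-x) := fun x => by
    have : (reflX f : ℝ → ℂ) = fun x => f (-x) := rfl
    rw [this, deriv_comp_neg]
  rw [neg_apply, reflX_apply, coe_dunklS, coe_dunklS]
  simp only [dunklOp, hd, reflX_apply, neg_eq_zero, neg_neg]
  split_ifs with hx
  · subst hx
    simp
  · push_cast
    ring

lemma dunklS_mulX (k : ℝ) (f : 𝓢(ℝ, ℂ)) :
    dunklS k (mulX f) = mulX (dunklS k f) + f + (2 * k + 1 : ℂ) • reflX f := by
  ext x
  have hd : ∀ x : ℝ, deriv ⇑(mulX f) x = f x + x * deriv f x := fun x => by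
    have : (mulX f : ℝ → ℂ) = fun x : ℝ => (x : ℂ) * f x := funext (mulX_apply f)
    rw [this]
    refine ((Complex.ofRealCLM.hasDerivAt (x := x)).mul
      (f.differentiable_real x).hasDerivAt).deriv.trans ?_
    simp
  simp only [add_apply, smul_apply, mulX_apply, reflX_apply, smul_eq_mul]
  rw [coe_dunklS, coe_dunklS]
  simp only [dunklOp, hd, mulX_apply]
  split_ifs with hx
  · subst hx
    simp
    ring
  · have hx' : (x : ℂ) ≠ 0 := by exact_mod_cast hx
    push_cast
    field_simp
    ring

lemma iterate_dunklS_mulX {k : ℝ} (hk : -(1/2) ≤ k) (f : 𝓢(ℝ, ℂ)) (n : ℕ) :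
    ∃ c : ℝ, 0 ≤ c ∧ c ≤ 2 * k + 1 ∧ (dunklS k)^[n + 1] (mulX f) =
      mulX ((dunklS k)^[n + 1] f) + ((n : ℂ) + 1) • (dunklS k)^[n] f +
        (c : ℂ) • reflX ((dunklS k)^[n] f) := by
  induction n with
  | zero =>
    refine ⟨2 * k + 1, by linarith, le_rfl, ?_⟩
    simp [dunklS_mulX]
  | succ n ih =>
    obtain ⟨c, hc, hc', h⟩ := ih
    refine ⟨2 * k + 1 - c, by linarith, by linarith, ?_⟩
    rw [Function.iterate_succ_apply', h, dunklS_add, dunklS_add, dunklS_mulX, dunklS_smul,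
      dunklS_smul, dunklS_reflX, ← Function.iterate_succ_apply' (dunklS k),
      ← Function.iterate_succ_apply' (dunklS k)]
    ext x
    simp only [add_apply, smul_apply, neg_apply, smul_eq_mul]
    push_cast
    ring

/-- If the Dunkl transform of `h` vanishes outside `[-σ, σ]`, so does that of `x * h`. -/
lemma dunklT_mulX_eq_zero {k : ℝ} (hk : -(1/2) ≤ k) {h : 𝓢(ℝ, ℂ)} {σ : ℝ}
    (hh : ∀ l, σ < |l| → dunklT k h l = 0) (l : ℝ) (hl : σ < |l|) :
    dunklT k (mulX h) l = 0 := by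
  have hd : deriv (dunklT k h) l = 0 := by
    have : dunklT k h =ᶠ[𝓝 l] fun _ => 0 := by
      filter_upwards [continuous_abs.continuousAt.eventually (lt_mem_nhds hl)] with y hy
      exact hh y hy
    rw [this.deriv_eq, deriv_const]
  rw [dunklT_mulX hk, dunklOp, hh l hl, hh (-l) (by rwa [abs_neg])]
  split_ifs with h0
  · subst h0
    rw [hd, mul_zero, mul_zero]
  · rw [hd]
    simp

lemma norm_iterate_dunklS_le {k : ℝ} (hk : -(1/2) ≤ k) {h : 𝓢(ℝ, ℂ)} {σ : ℝ}
    (hh : ∀ l, σ < |l| → dunklT k h l = 0) :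
    ∃ C : ℝ, 0 ≤ C ∧ ∀ (n : ℕ) (x : ℝ), ‖((dunklS k)^[n] h) x‖ ≤ C * σ ^ n := by
  have hc : 0 < ‖gaussC k ^ 2‖ := norm_pos_iff.mpr (pow_ne_zero 2 (gaussC_ne_zero hk))
  refine ⟨(∫ l, ‖dunklT k h l‖ ∂(muK k)) / ‖gaussC k ^ 2‖, by positivity, fun n x => ?_⟩
  rw [div_mul_eq_mul_div, le_div_iff₀ hc, mul_comm, ← norm_mul,
    ← integral_dunklT_mul_dunklE hk, ← integral_mul_const]
  refine norm_integral_le_of_norm_le ((integrable_dunklT hk h).norm.mul_const _)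
    (Eventually.of_forall fun l => ?_)
  rw [dunklT_iterate_dunklS hk, norm_mul, norm_mul, norm_pow, norm_mul, Complex.norm_I, one_mul,
    Complex.norm_real]
  rcases lt_or_ge σ |l| with hl | hl
  · simp [hh l hl]
  · calc _ ≤ |l| ^ n * ‖dunklT k h l‖ * 1 := by
          gcongr
          · exact le_rfl
          · exact norm_dunklE_le_one hk _
      _ ≤ σ ^ n * ‖dunklT k h l‖ * 1 := by gcongr
      _ = _ := by ring

lemma pow_mul_norm_iterate_dunklS_le {k : ℝ} (hk : -(1/2) ≤ k) {σ ρ : ℝ} (hσ : 0 ≤ σ)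
    (hρ : σ < ρ) (m : ℕ) : ∀ {h : 𝓢(ℝ, ℂ)} (_ : ∀ l, σ < |l| → dunklT k h l = 0),
    ∃ C : ℝ, 0 ≤ C ∧ ∀ (n : ℕ) (x : ℝ),
      |x| ^ m * ‖((dunklS k)^[n] h) x‖ ≤ C * ((n : ℝ) + 1) ^ m * ρ ^ n := by
  have hρ0 : 0 < ρ := hσ.trans_lt hρ
  induction m with
  | zero =>
    intro h hh
    obtain ⟨C, hC0, hC⟩ := norm_iterate_dunklS_le hk hh
    refine ⟨C, hC0, fun n x => ?_⟩
    rw [pow_zero, pow_zero, one_mul, mul_one]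
    exact (hC n x).trans (by gcongr)
  | succ m ih =>
    intro h hh
    obtain ⟨C, hC0, hC⟩ := ih hh
    obtain ⟨C', hC0', hC'⟩ := ih (dunklT_mulX_eq_zero hk hh)
    have hk0 : 0 ≤ 2 * k + 1 := by linarith
    refine ⟨C' + (1 + (2 * k + 1)) * (C / ρ), by positivity, fun n x => ?_⟩
    rcases n with _ | n
    · have h1 := hC' 0 x
      simp only [Function.iterate_zero, id_eq, mulX_apply, norm_mul, Complex.norm_real,
        Real.norm_eq_abs, Nat.cast_zero, zero_add, one_pow, mul_one, pow_zero] at h1 ⊢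
      have : 0 ≤ (1 + (2 * k + 1)) * (C / ρ) := by positivity
      calc _ = |x| ^ m * (|x| * ‖h x‖) := by ring
        _ ≤ _ := by linarith
    · obtain ⟨c, hc, hc', hcomm⟩ := iterate_dunklS_mulX hk h n
      have hx : (x : ℂ) * ((dunklS k)^[n + 1] h) x = ((dunklS k)^[n + 1] (mulX h)) x -
          ((n : ℂ) + 1) * ((dunklS k)^[n] h) x - c * ((dunklS k)^[n] h) (-x) := by
        rw [hcomm]
        simp only [add_apply, smul_apply, mulX_apply, reflX_apply, smul_eq_mul]
        ring
      have hn : ‖(x : ℂ) * ((dunklS k)^[n + 1] h) x‖ ≤ ‖((dunklS k)^[n + 1] (mulX h)) x‖ +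
          (n + 1) * ‖((dunklS k)^[n] h) x‖ + (2 * k + 1) * ‖((dunklS k)^[n] h) (-x)‖ := by
        rw [hx]
        refine (norm_sub_le _ _).trans (add_le_add ((norm_sub_le _ _).trans
          (add_le_add le_rfl ?_)) ?_)
        · rw [norm_mul, show (n : ℂ) + 1 = ((n + 1 : ℕ) : ℂ) by push_cast; rfl, Complex.norm_natCast]
          push_cast
          exact le_rfl
        · rw [norm_mul, Complex.norm_real, Real.norm_of_nonneg hc]
          gcongr
      have h1 := hC' (n + 1) x
      have h2 := hC n x
      have h3 := hC n (-x)
      rw [abs_neg] at h3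
      push_cast at h1 ⊢
      have hnn : (0 : ℝ) ≤ n := n.cast_nonneg
      have hn1 : (1 : ℝ) ≤ (n : ℝ) + 1 + 1 := by linarith
      calc |x| ^ (m + 1) * ‖((dunklS k)^[n + 1] h) x‖
          = |x| ^ m * ‖(x : ℂ) * ((dunklS k)^[n + 1] h) x‖ := by
            rw [norm_mul, Complex.norm_real, Real.norm_eq_abs]; ring
        _ ≤ |x| ^ m * (‖((dunklS k)^[n + 1] (mulX h)) x‖ +
          (n + 1) * ‖((dunklS k)^[n] h) x‖ + (2 * k + 1) * ‖((dunklS k)^[n] h) (-x)‖) := by gcongr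
        _ = |x| ^ m * ‖((dunklS k)^[n + 1] (mulX h)) x‖ +
          (n + 1) * (|x| ^ m * ‖((dunklS k)^[n] h) x‖) +
          (2 * k + 1) * (|x| ^ m * ‖((dunklS k)^[n] h) (-x)‖) := by ring
        _ ≤ C' * ((n : ℝ) + 1 + 1) ^ m * ρ ^ (n + 1) +
          (n + 1) * (C * ((n : ℝ) + 1) ^ m * ρ ^ n) +
          (2 * k + 1) * (C * ((n : ℝ) + 1) ^ m * ρ ^ n) := by gcongr
        _ ≤ C' * ((n : ℝ) + 1 + 1) ^ (m + 1) * ρ ^ (n + 1) +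
          ((n : ℝ) + 1 + 1) * (C * ((n : ℝ) + 1 + 1) ^ m * ρ ^ n) +
          (2 * k + 1) * (C * ((n : ℝ) + 1 + 1) ^ (m + 1) * ρ ^ n) := by
            have e1 : ((n : ℝ) + 1) ^ m ≤ ((n : ℝ) + 1 + 1) ^ m := by gcongr; linarith
            have e2 : ((n : ℝ) + 1 + 1) ^ m ≤ ((n : ℝ) + 1 + 1) ^ (m + 1) :=
              pow_le_pow_right₀ hn1 (by omega)
            have e3 := e1.trans e2
            have e4 : (n : ℝ) + 1 ≤ (n : ℝ) + 1 + 1 := by linarith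
            gcongr
        _ = _ := by
            field_simp
            ring

/-- Growth of the iterated Dunkl operator on functions with compactly supported transform. -/
lemma eventually_eLpNorm_le {k : ℝ} (hk : -(1/2) ≤ k) {h : 𝓢(ℝ, ℂ)} {σ ρ : ℝ} (hσ : 0 ≤ σ)
    (hρ : σ < ρ) (hh : ∀ l, σ < |l| → dunklT k h l = 0) (p : ℝ≥0∞) :
    ∀ᶠ n : ℕ in atTop, eLpNorm ((dunklOp k)^[n] h) p (muK k) ≤ ENNReal.ofReal ρ ^ n := by
  have := muK_hasTemperateGrowth hk
  obtain ⟨M, K, hMK⟩ := SchwartzMap.eLpNorm_le_seminorm ℂ ℂ p (muK k)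
  obtain ⟨ρ₁, hρ₁, hρ₁'⟩ := exists_between hρ
  have hρ₁0 : 0 < ρ₁ := hσ.trans_lt hρ₁
  have hρ0 : 0 < ρ := hρ₁0.trans hρ₁'
  choose C hC0 hC using fun m => pow_mul_norm_iterate_dunklS_le hk hσ hρ₁ m hh
  set B : ℝ := ∑ m ∈ Finset.range (M + 1), C m with hB
  have hB0 : 0 ≤ B := Finset.sum_nonneg fun m _ => hC0 m
  have hsem : ∀ n : ℕ, ((Finset.Iic (M, 0)).sup (schwartzSeminormFamily ℂ ℝ ℂ))
      ((dunklS k)^[n] h) ≤ B * ((n : ℝ) + 1) ^ M * ρ₁ ^ n := fun n => by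
    refine Seminorm.finset_sup_apply_le (by positivity) fun mi hmi => ?_
    obtain ⟨m, i⟩ := mi
    rw [Finset.mem_Iic, Prod.mk_le_mk] at hmi
    obtain ⟨hm, hi⟩ := hmi
    obtain rfl : i = 0 := by omega
    refine SchwartzMap.seminorm_le_bound ℂ m 0 _ (by positivity) fun x => ?_
    rw [norm_iteratedFDeriv_zero]
    refine (hC m n x).trans ?_
    gcongr
    · exact Finset.single_le_sum (f := C) (fun m _ => hC0 m) (Finset.mem_range.mpr (by omega))
    · linarith [(n.cast_nonneg : (0 : ℝ) ≤ n)]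
  have hlim : Tendsto (fun n : ℕ => (K : ℝ) * B * (((n : ℝ) + 1) ^ M * (ρ₁ / ρ) ^ n)) atTop
      (𝓝 ((K : ℝ) * B * 0)) := by
    refine Tendsto.const_mul _ ?_
    have h1 := (tendsto_pow_const_mul_const_pow_of_lt_one M (r := ρ₁ / ρ) (by positivity)
      ((div_lt_one (by linarith)).mpr hρ₁')).comp (tendsto_add_atTop_nat 1)
    have h2 := h1.mul_const (ρ₁ / ρ)⁻¹
    rw [zero_mul] at h2
    refine h2.congr fun n => ?_
    have : ρ₁ / ρ ≠ 0 := by positivity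
    simp only [Function.comp]
    push_cast
    rw [pow_succ]
    field_simp
  rw [mul_zero] at hlim
  filter_upwards [hlim.eventually_le_const one_pos] with n hn
  rw [← coe_iterate_dunklS]
  refine (hMK _).trans ?_
  rw [← ENNReal.ofReal_coe_nnreal, ← ENNReal.ofReal_mul (NNReal.coe_nonneg K), ← ENNReal.ofReal_pow (by linarith)]
  refine ENNReal.ofReal_le_ofReal ?_
  have hρn : 0 < ρ ^ n := pow_pos (by linarith) n
  calc (K : ℝ) * _ ≤ K * (B * ((n : ℝ) + 1) ^ M * ρ₁ ^ n) := by gcongr; exact hsem n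
    _ = (K : ℝ) * B * (((n : ℝ) + 1) ^ M * (ρ₁ / ρ) ^ n) * ρ ^ n := by
        rw [div_pow]; field_simp
    _ ≤ 1 * ρ ^ n := by gcongr
    _ = ρ ^ n := one_mul _

lemma enorm_integral_mul_conj_le {α : Type*} [MeasurableSpace α] {μ : Measure α} {u v : α → ℂ}
    (hu : AEStronglyMeasurable u μ) (hv : AEStronglyMeasurable v μ) (p q : ℝ≥0∞)
    [ENNReal.HolderConjugate p q] :
    ‖∫ x, u x * (starRingEnd ℂ) (v x) ∂μ‖ₑ ≤ eLpNorm u p μ * eLpNorm v q μ := by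
  have h1 := eLpNorm_le_eLpNorm_mul_eLpNorm_of_nnnorm (p := p) (q := q) (r := 1) hu hv
    (fun a b => a * (starRingEnd ℂ) b) 1 (Eventually.of_forall fun x => by simp)
  rw [ENNReal.coe_one, one_mul, eLpNorm_one_eq_lintegral_enorm] at h1
  exact (enorm_integral_le_lintegral_enorm _).trans h1

lemma integrable_norm_sq_dunklT {k : ℝ} (hk : -(1/2) ≤ k) (h : 𝓢(ℝ, ℂ)) :
    Integrable (fun l => ‖dunklT k h l‖ ^ 2) (muK k) := by
  simp only [pow_two]
  refine (integrable_dunklT hk h).norm.mul_bdd (c := ∫ x, ‖h x‖ ∂(muK k))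
    (differentiable_dunklT hk h).continuous.norm.aestronglyMeasurable
    (Eventually.of_forall fun l => ?_)
  rw [norm_norm]
  exact norm_dunklT_le hk h l

/-- The `L²` mass of the Dunkl transform, weighted towards `|l| > r`. -/
noncomputable def tailMass (k r : ℝ) (g : 𝓢(ℝ, ℂ)) (l : ℝ) : ℝ :=
  ‖dunklT k g l‖ ^ 2 * min 1 (max (|l| - r) 0)

lemma tailMass_nonneg (k r : ℝ) (g : 𝓢(ℝ, ℂ)) (l : ℝ) : 0 ≤ tailMass k r g l := by
  unfold tailMass; positivity

lemma tailMass_le (k r : ℝ) (g : 𝓢(ℝ, ℂ)) (l : ℝ) : tailMass k r g l ≤ ‖dunklT k g l‖ ^ 2 :=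
  mul_le_of_le_one_right (by positivity) (min_le_left _ _)

lemma continuous_tailMass {k : ℝ} (hk : -(1/2) ≤ k) (r : ℝ) (g : 𝓢(ℝ, ℂ)) :
    Continuous (tailMass k r g) := by
  have := (differentiable_dunklT hk g).continuous
  unfold tailMass
  fun_prop

lemma integrable_tailMass {k : ℝ} (hk : -(1/2) ≤ k) (r : ℝ) (g : 𝓢(ℝ, ℂ)) :
    Integrable (tailMass k r g) (muK k) :=
  (integrable_norm_sq_dunklT hk g).mono' (continuous_tailMass hk r g).aestronglyMeasurable
    (Eventually.of_forall fun l => by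
      rw [Real.norm_of_nonneg (tailMass_nonneg k r g l)]
      exact tailMass_le k r g l)

lemma integral_tailMass_pos {k : ℝ} (hk : -(1/2) ≤ k) {r l₀ : ℝ} (hr : 0 ≤ r) (hl₀ : r < |l₀|)
    {g : 𝓢(ℝ, ℂ)} (hg : dunklT k g l₀ ≠ 0) : 0 < ∫ l, tailMass k r g l ∂(muK k) := by
  have hw := continuous_wK hk
  have ht := continuous_tailMass hk r g
  have hcont : Continuous fun l => wK k l * tailMass k r g l := hw.mul ht
  have e : ∫ l, tailMass k r g l ∂(muK k) = ∫ l, wK k l * tailMass k r g l := by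
    rw [muK_eq, integral_withDensity_eq_integral_toReal_smul
      hw.measurable.ennreal_ofReal (by simp)]
    simp only [ENNReal.toReal_ofReal (wK_nonneg hk _), smul_eq_mul]
  have hi : Integrable fun l => wK k l * tailMass k r g l := by
    have := integrable_tailMass hk r g
    rw [muK_eq, integrable_withDensity_iff_integrable_smul'
      hw.measurable.ennreal_ofReal (by simp)] at this
    simpa only [ENNReal.toReal_ofReal (wK_nonneg hk _), smul_eq_mul] using this
  rw [e]
  refine integral_pos_of_integrable_nonneg_nonzero (x := l₀) hcont hi
    (fun l => mul_nonneg (wK_nonneg hk l) (tailMass_nonneg k r g l)) (mul_ne_zero ?_ ?_)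
  · have : 0 < |l₀| := hr.trans_lt hl₀
    exact (div_pos (Real.rpow_pos_of_pos this _) (wK_const_pos hk)).ne'
  · have h1 : 0 < |l₀| - r := by linarith
    have h2 : 0 < ‖dunklT k g l₀‖ := norm_pos_iff.mpr hg
    exact (mul_pos (by positivity) (lt_min one_pos (lt_max_of_lt_left h1))).ne'

lemma norm_integral_dunklT_mul_conj_iterate {k : ℝ} (hk : -(1/2) ≤ k) (g : 𝓢(ℝ, ℂ))
    {n e m : ℕ} (hm : n + e = 2 * m) :
    ‖∫ l, dunklT k ((dunklS k)^[n] g) l *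
      (starRingEnd ℂ) (dunklT k ((dunklS k)^[e] g) l) ∂(muK k)‖ =
    ∫ l, ‖dunklT k ((dunklS k)^[m] g) l‖ ^ 2 ∂(muK k) := by
  have h1 : ∀ l, dunklT k ((dunklS k)^[n] g) l *
      (starRingEnd ℂ) (dunklT k ((dunklS k)^[e] g) l) =
      (-1) ^ (e + m) * ((‖dunklT k ((dunklS k)^[m] g) l‖ ^ 2 : ℝ) : ℂ) := fun l => by
    rw [dunklT_iterate_dunklS hk, dunklT_iterate_dunklS hk, dunklT_iterate_dunklS hk,
      map_mul, map_pow, map_mul, Complex.conj_I, Complex.conj_ofReal, norm_mul, norm_pow,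
      norm_mul, Complex.norm_I, one_mul, Complex.norm_real, Real.norm_eq_abs,
      mul_pow (|l| ^ m : ℝ), ← pow_mul, mul_comm m 2, pow_mul, sq_abs]
    push_cast
    rw [← Complex.mul_conj']
    have h2 : (I * (l : ℂ)) ^ n * (-I * (l : ℂ)) ^ e = (-1) ^ (e + m) * ((l : ℂ) ^ 2) ^ m := by
      calc _ = (-1) ^ e * (I * (l : ℂ)) ^ (n + e) := by
            rw [neg_mul, neg_pow]; ring
        _ = (-1) ^ e * ((-1) * (l : ℂ) ^ 2) ^ m := by
            rw [hm, pow_mul, mul_pow, Complex.I_sq]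
        _ = _ := by rw [mul_pow, pow_add]; ring
    linear_combination dunklT k g l * (starRingEnd ℂ) (dunklT k g l) * h2
  simp only [h1]
  rw [integral_const_mul, norm_mul, norm_pow, norm_neg, norm_one, one_pow, one_mul]
  have h3 : ∫ l, ((‖dunklT k ((dunklS k)^[m] g) l‖ ^ 2 : ℝ) : ℂ) ∂(muK k) =
      ((∫ l, ‖dunklT k ((dunklS k)^[m] g) l‖ ^ 2 ∂(muK k) : ℝ) : ℂ) := integral_ofReal
  rw [h3, Complex.norm_real, Real.norm_of_nonneg (integral_nonneg fun l => by positivity)]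

lemma pow_mul_integral_tailMass_le {k : ℝ} (hk : -(1/2) ≤ k) {r : ℝ} (hr : 0 ≤ r)
    (g : 𝓢(ℝ, ℂ)) (m : ℕ) : r ^ (2 * m) * ∫ l, tailMass k r g l ∂(muK k) ≤
      ∫ l, ‖dunklT k ((dunklS k)^[m] g) l‖ ^ 2 ∂(muK k) := by
  rw [← integral_const_mul]
  refine integral_mono ((integrable_tailMass hk r g).const_mul _)
    (integrable_norm_sq_dunklT hk _) fun l => ?_
  beta_reduce
  rw [dunklT_iterate_dunklS hk, norm_mul, norm_pow, norm_mul, Complex.norm_I, one_mul,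
    Complex.norm_real, Real.norm_eq_abs, mul_pow, ← pow_mul, mul_comm m 2]
  rcases le_total |l| r with h | h
  · rw [tailMass, max_eq_right (by linarith), min_eq_right zero_le_one, mul_zero, mul_zero]
    positivity
  · exact mul_le_mul (by gcongr) (tailMass_le k r g l) (tailMass_nonneg k r g l) (by positivity)

lemma exists_mul_pow_le_eLpNorm {k : ℝ} (hk : -(1/2) ≤ k) {r l₀ : ℝ} (hr : 0 ≤ r)
    (hl₀ : r < |l₀|) {g : 𝓢(ℝ, ℂ)} (hg : dunklT k g l₀ ≠ 0) {p : ℝ≥0∞} (hp : 1 ≤ p) (e : ℕ) :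
    ∃ c : ℝ, 0 < c ∧ ∀ n m : ℕ, n + e = 2 * m →
      ENNReal.ofReal (c * r ^ (n + e)) ≤ eLpNorm ((dunklS k)^[n] g) p (muK k) := by
  have := muK_hasTemperateGrowth hk
  have := ENNReal.HolderConjugate.conjExponent hp
  set φ := (dunklS k)^[e] g with hφ
  set Q := eLpNorm φ p.conjExponent (muK k) with hQ
  have hQt : Q ≠ ⊤ := (φ.eLpNorm_lt_top _ _).ne
  have hc : 0 < ‖gaussC k ^ 2‖ := norm_pos_iff.mpr (pow_ne_zero 2 (gaussC_ne_zero hk))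
  have hT := integral_tailMass_pos hk hr hl₀ hg
  have hQ0 : 0 ≤ Q.toReal := ENNReal.toReal_nonneg
  refine ⟨(∫ l, tailMass k r g l ∂(muK k)) / (‖gaussC k ^ 2‖ * (Q.toReal + 1)), by positivity,
    fun n m hm => ENNReal.ofReal_le_of_le_toReal ?_⟩
  set u := (dunklS k)^[n] g with hu
  have hNt : eLpNorm u p (muK k) ≠ ⊤ := (u.eLpNorm_lt_top _ _).ne
  have h1 : ‖∫ x, u x * (starRingEnd ℂ) (φ x) ∂(muK k)‖ ≤
      (eLpNorm u p (muK k)).toReal * Q.toReal := by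
    have := ENNReal.toReal_mono (ENNReal.mul_ne_top hNt hQt)
      (enorm_integral_mul_conj_le (μ := muK k) u.continuous.aestronglyMeasurable
        φ.continuous.aestronglyMeasurable p p.conjExponent)
    rwa [toReal_enorm, ENNReal.toReal_mul] at this
  have h2 := pow_mul_integral_tailMass_le hk hr g m
  rw [← norm_integral_dunklT_mul_conj_iterate hk g hm, integral_dunklT_mul_conj hk, norm_mul]
    at h2
  have hN0 : 0 ≤ (eLpNorm u p (muK k)).toReal := ENNReal.toReal_nonneg
  rw [div_mul_eq_mul_div, div_le_iff₀ (by positivity), hm]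
  calc _ = r ^ (2 * m) * ∫ l, tailMass k r g l ∂(muK k) := mul_comm _ _
    _ ≤ _ := h2
    _ ≤ ‖gaussC k ^ 2‖ * ((eLpNorm u p (muK k)).toReal * Q.toReal) := by gcongr
    _ ≤ ‖gaussC k ^ 2‖ * ((eLpNorm u p (muK k)).toReal * (Q.toReal + 1)) := by
        gcongr; linarith
    _ = _ := by ring

/-- Lower bound for the growth of the iterated Dunkl operator. -/
lemma eventually_le_eLpNorm {k : ℝ} (hk : -(1/2) ≤ k) {r l₀ : ℝ} (hr : 0 ≤ r)
    (hl₀ : r < |l₀|) {g : 𝓢(ℝ, ℂ)} (hg : dunklT k g l₀ ≠ 0) {p : ℝ≥0∞} (hp : 1 ≤ p) :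
    ∀ᶠ n : ℕ in atTop, ENNReal.ofReal r ^ n ≤ eLpNorm ((dunklOp k)^[n] g) p (muK k) := by
  obtain ⟨r₁, hr₁, hr₁'⟩ := exists_between hl₀
  have hr₁0 : 0 < r₁ := hr.trans_lt hr₁
  have hlim : Tendsto (fun n : ℕ => (r / r₁) ^ n) atTop (𝓝 0) :=
    tendsto_pow_atTop_nhds_zero_of_lt_one (by positivity) ((div_lt_one hr₁0).mpr hr₁)
  have key : ∀ e : ℕ, ∀ᶠ n : ℕ in atTop, ∀ m, n + e = 2 * m →
      ENNReal.ofReal r ^ n ≤ eLpNorm ((dunklOp k)^[n] g) p (muK k) := fun e => by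
    obtain ⟨c, hc, h⟩ := exists_mul_pow_le_eLpNorm hk hr₁0.le hr₁' hg hp e
    filter_upwards [hlim.eventually_le_const (show 0 < c * r₁ ^ e by positivity)] with n hn m hm
    rw [← coe_iterate_dunklS]
    refine le_trans ?_ (h n m hm)
    rw [← ENNReal.ofReal_pow hr]
    refine ENNReal.ofReal_le_ofReal ?_
    rw [div_pow, div_le_iff₀ (by positivity)] at hn
    refine hn.trans_eq ?_
    ring
  filter_upwards [key 0, key 1] with n h0 h1
  rcases Nat.even_or_odd' n with ⟨m, hm | hm⟩
  · exact h0 m (by omega)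
  · exact h1 (m + 1) (by omega)

/-- Conjugation by a chirp turns the linear canonical Dunkl operator into the Dunkl operator. -/
lemma lcdOp_chirp_mul (k a b : ℝ) (h : 𝓢(ℝ, ℂ)) :
    lcdOp k a b (fun x : ℝ => cexp (-((a / b / 2 : ℝ) : ℂ) * I * (x : ℂ) ^ 2) * h x) =
      fun x : ℝ => cexp (-((a / b / 2 : ℝ) : ℂ) * I * (x : ℂ) ^ 2) * dunklS k h x := by
  funext x
  have hd : ∀ x : ℝ, deriv (fun x : ℝ => cexp (-((a / b / 2 : ℝ) : ℂ) * I * (x : ℂ) ^ 2) * h x) x =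
      _ := fun x => ((hasDerivAt_exp_mul_sq _ x).mul (h.differentiable_real x).hasDerivAt).deriv
  rw [coe_dunklS]
  simp only [lcdOp, dunklOp, hd, ofReal_neg, neg_sq]
  split_ifs with hx
  · subst hx
    simp
  · push_cast
    ring

lemma iterate_lcdOp (k a b : ℝ) {f g : 𝓢(ℝ, ℂ)}
    (hg : ∀ x, g x = cexp (((a / b / 2 : ℝ) : ℂ) * I * (x : ℂ) ^ 2) * f x) (n : ℕ) :
    (lcdOp k a b)^[n] f =
      fun x : ℝ => cexp (-((a / b / 2 : ℝ) : ℂ) * I * (x : ℂ) ^ 2) * ((dunklS k)^[n] g) x := by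
  induction n with
  | zero =>
    funext x
    simp only [Function.iterate_zero, id_eq]
    rw [hg, ← mul_assoc, ← Complex.exp_add]
    simp
  | succ n ih =>
    rw [Function.iterate_succ_apply', ih, lcdOp_chirp_mul, Function.iterate_succ_apply']

lemma eLpNorm_iterate_lcdOp (k a b : ℝ) {f g : 𝓢(ℝ, ℂ)}
    (hg : ∀ x, g x = cexp (((a / b / 2 : ℝ) : ℂ) * I * (x : ℂ) ^ 2) * f x) (n : ℕ) (p : ℝ≥0∞)
    (μ : Measure ℝ) :
    eLpNorm ((lcdOp k a b)^[n] f) p μ = eLpNorm ((dunklOp k)^[n] g) p μ := by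
  rw [iterate_lcdOp k a b hg, ← coe_iterate_dunklS]
  refine eLpNorm_congr_norm_ae (Eventually.of_forall fun x => ?_)
  rw [norm_mul, ← ofReal_neg, norm_cexp_mul_I_sq, one_mul]

lemma lcdt_ne_zero_iff (k a d : ℝ) {b : ℝ} (hb : b ≠ 0) {f g : 𝓢(ℝ, ℂ)}
    (hg : ∀ x, g x = cexp (((a / b / 2 : ℝ) : ℂ) * I * (x : ℂ) ^ 2) * f x) (lam : ℝ) :
    lcdt k a b d f lam ≠ 0 ↔ dunklT k g (lam / b) ≠ 0 := by
  have h : lcdt k a b d f lam = ((I * (b : ℂ)) ^ ((k : ℂ) + 1))⁻¹ *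
      (cexp (I / 2 * (((d / b : ℝ) : ℂ) * (lam : ℂ) ^ 2)) * dunklT k g (lam / b)) := by
    rw [lcdt, dunklT, ← integral_const_mul (cexp _)]
    congr 2
    funext x
    rw [hg, mul_add, Complex.exp_add, neg_div]
    rw [show I / 2 * (((a / b : ℝ) : ℂ) * (x : ℂ) ^ 2) =
      ((a / b / 2 : ℝ) : ℂ) * I * (x : ℂ) ^ 2 by push_cast; ring]
    ring
  have hb' : (I * (b : ℂ)) ^ ((k : ℂ) + 1) ≠ 0 := fun h0 =>
    mul_ne_zero I_ne_zero (ofReal_ne_zero.mpr hb) ((Complex.cpow_eq_zero_iff _ _).mp h0).1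
  simp [h, hb', Complex.exp_ne_zero]

end

/-- **Real Paley-Wiener theorem.** For `f ∈ S(ℝ)` and `1 ≤ p ≤ ∞`, the limit
`lim_n ‖Λ_{k,M⁻¹}ⁿ f‖_{L^p_k}^{1/n}` exists in `[0,∞]` and equals
`σ_f = sup{|λ/b| : λ ∈ supp D_k^M f}`. -/
theorem stmt_0 (k a b c d : ℝ) (hk : -(1/2) ≤ k) (hM : a * d - b * c = 1) (hb : b ≠ 0)
    (f : SchwartzMap ℝ ℂ) (p : ℝ≥0∞) (hp : 1 ≤ p) :
    Filter.Tendsto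
      (fun n : ℕ => (eLpNorm ((lcdOp k a b)^[n] ⇑f) p (muK k)) ^ (1 / (n : ℝ)))
      Filter.atTop
      (𝓝 (sSup ((fun lam : ℝ => ENNReal.ofReal |lam / b|) '' tsupport (lcdt k a b d ⇑f)))) := by
  obtain ⟨g, hg⟩ := exists_schwartzMap_chirp_mul (a / b / 2) f
  simp only [eLpNorm_iterate_lcdOp k a b hg, one_div]
  set L := sSup ((fun lam : ℝ => ENNReal.ofReal |lam / b|) '' tsupport (lcdt k a b d ⇑f)) with hL
  refine tendsto_order.mpr ⟨fun t ht => ?_, fun t ht => ?_⟩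
  · obtain ⟨_, ⟨l, hl, rfl⟩, htl⟩ := lt_sSup_iff.mp ht
    have hcont : Continuous fun l : ℝ => ENNReal.ofReal |l / b| :=
      ENNReal.continuous_ofReal.comp (by fun_prop)
    obtain ⟨l', hl', hne⟩ := mem_closure_iff.mp hl _ (isOpen_Ioi.preimage hcont) htl
    obtain ⟨r, hr, htr, hrl⟩ := ENNReal.lt_iff_exists_real_btwn.mp
      (show t < ENNReal.ofReal |l' / b| from hl')
    rw [ENNReal.ofReal_lt_ofReal_iff_of_nonneg hr] at hrl
    filter_upwards [eventually_le_eLpNorm hk hr hrl ((lcdt_ne_zero_iff k a d hb hg l').mp hne) hp,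
      eventually_ne_atTop 0] with n hn hn0
    calc t < ENNReal.ofReal r := htr
      _ = (ENNReal.ofReal r ^ n) ^ ((n : ℝ)⁻¹) := (ENNReal.pow_rpow_inv_natCast hn0 _).symm
      _ ≤ _ := ENNReal.rpow_le_rpow hn (by positivity)
  · obtain ⟨ρ, hρ, hLρ, hρt⟩ := ENNReal.lt_iff_exists_real_btwn.mp ht
    have hLt : L ≠ ⊤ := (hLρ.trans ENNReal.ofReal_lt_top).ne
    have hσρ : L.toReal < ρ := (ENNReal.lt_ofReal_iff_toReal_lt hLt).mp hLρ
    have hvan : ∀ l, L.toReal < |l| → dunklT k g l = 0 := fun l hl => by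
      by_contra hne
      have hlb : l * b / b = l := mul_div_cancel_right₀ l hb
      have h1 : lcdt k a b d f (l * b) ≠ 0 := by
        rwa [lcdt_ne_zero_iff k a d hb hg, hlb]
      have h2 : ENNReal.ofReal |l * b / b| ≤ L :=
        le_sSup ⟨l * b, subset_tsupport _ h1, rfl⟩
      rw [hlb, ENNReal.ofReal_le_iff_le_toReal hLt] at h2
      exact absurd h2 (not_le.mpr hl)
    filter_upwards [eventually_eLpNorm_le hk ENNReal.toReal_nonneg hσρ hvan p,
      eventually_ne_atTop 0] with n hn hn0
    calc _ ≤ (ENNReal.ofReal ρ ^ n) ^ ((n : ℝ)⁻¹) := ENNReal.rpow_le_rpow hn (by positivity)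
      _ = ENNReal.ofReal ρ := ENNReal.pow_rpow_inv_natCast hn0 _
      _ < t := hρt
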